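/- arXiv:1301.5030 — 7 statements merged into one kernel-verified Lean document; each statement's English description precedes it below -/
import Mathlib

section
/- The bounding number 𝔟 equals 𝔟₂, where 𝔟₂ is the least cardinal κ for which there exists a family of sequences (r^ξ_n)_{n∈ℕ} of strictly positive real numbers, indexed by ξ < κ, such that lim_n r^ξ_n = 0 for every ξ, and there is no strictly increasing sequence (n(i))_{i∈ℕ} of natural numbers such that ∑_i r^ξ_{n(i)} < ∞ for all ξ. -/
/-- `g` eventually dominates `f`. -/
def EventuallyDominates (g f : ℕ → ℕ) : Prop :=
  ∀ᶠ n in Filter.atTop, f n ≤ g n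

/-- The bounding number `𝔟`: the least cardinality of a family `F` of functions `ℕ → ℕ`
such that no single `g : ℕ → ℕ` eventually dominates every member of `F`. -/
noncomputable def boundingNumber : Cardinal :=
  sInf { κ | ∃ F : Set (ℕ → ℕ), Cardinal.mk F = κ ∧
    ∀ g : ℕ → ℕ, ∃ f ∈ F, ¬ EventuallyDominates g f }

/-- The cardinal `𝔟₂`: the least cardinal `κ` for which there is a family of strictly
positive null sequences `(r ξ n)`, indexed by a type of cardinality `κ`, such that no
strictly increasing `n : ℕ → ℕ` makes `∑ i, r ξ (n i)` converge for all `ξ`. -/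
noncomputable def b2 : Cardinal :=
  sInf { κ | ∃ (ι : Type) (r : ι → ℕ → ℝ), Cardinal.mk ι = κ ∧
    (∀ ξ n, 0 < r ξ n) ∧
    (∀ ξ, Filter.Tendsto (r ξ) Filter.atTop (nhds 0)) ∧
    ¬ ∃ n : ℕ → ℕ, StrictMono n ∧ ∀ ξ, Summable (fun i => r ξ (n i)) }

/-- A strictly increasing function lying above `f`. -/
def strictMajorant (f : ℕ → ℕ) (k : ℕ) : ℕ :=
  k + ∑ j ∈ Finset.range (k + 1), f j

theorem strictMono_strictMajorant (f : ℕ → ℕ) : StrictMono (strictMajorant f) := by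
  refine strictMono_nat_of_lt_succ fun k => ?_
  simp only [strictMajorant]
  rw [Finset.sum_range_succ _ (k + 1)]
  omega

theorem le_strictMajorant (f : ℕ → ℕ) (k : ℕ) : f k ≤ strictMajorant f k := by
  rw [strictMajorant, Finset.sum_range_succ]
  omega

theorem exists_le_strictMajorant (f : ℕ → ℕ) (m : ℕ) : ∃ k, m ≤ strictMajorant f k :=
  ⟨m, (strictMono_strictMajorant f).le_apply⟩

/-- The null sequence taking the value `1 / (k + 1)` on the interval
`(strictMajorant f (k - 1), strictMajorant f k]`. -/
noncomputable def slowNullSeq (f : ℕ → ℕ) (m : ℕ) : ℝ :=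
  1 / ((Nat.find (exists_le_strictMajorant f m) : ℝ) + 1)

theorem slowNullSeq_pos (f : ℕ → ℕ) (m : ℕ) : 0 < slowNullSeq f m :=
  Nat.one_div_pos_of_nat

theorem tendsto_slowNullSeq (f : ℕ → ℕ) :
    Filter.Tendsto (slowNullSeq f) Filter.atTop (nhds 0) := by
  refine (tendsto_one_div_add_atTop_nhds_zero_nat (𝕜 := ℝ)).comp
    (Filter.tendsto_atTop.2 fun K => ?_)
  filter_upwards [Filter.eventually_gt_atTop (strictMajorant f K)] with m hm
  refine (Nat.le_find_iff _ _).2 fun j hj => not_le.2 ?_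
  exact ((strictMono_strictMajorant f).monotone hj.le).trans_lt hm

theorem one_div_le_slowNullSeq {f : ℕ → ℕ} {m k : ℕ} (h : m ≤ strictMajorant f k) :
    1 / ((k : ℝ) + 1) ≤ slowNullSeq f m :=
  Nat.one_div_le_one_div (Nat.find_min' _ h)

/-- A subsequence along which `slowNullSeq f` is summable yields a function dominating `f`. -/
theorem eventuallyDominates_of_summable_slowNullSeq {f n : ℕ → ℕ} (hn : StrictMono n)
    (hs : Summable fun i => slowNullSeq f (n i)) :
    EventuallyDominates (fun k => n ((k + 1) ^ 2)) f := by
  obtain ⟨K, hK⟩ := exists_nat_gt (∑' i, slowNullSeq f (n i))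
  filter_upwards [Filter.eventually_ge_atTop K] with k hk
  by_contra! hlt
  have hterm : ∀ i ∈ Finset.range ((k + 1) ^ 2),
      1 / ((k : ℝ) + 1) ≤ slowNullSeq f (n i) := fun i hi =>
    one_div_le_slowNullSeq <| (hn (Finset.mem_range.1 hi)).le.trans <|
      hlt.le.trans (le_strictMajorant f k)
  have hsum := Finset.card_nsmul_le_sum _ _ _ hterm
  have htsum := hs.sum_le_tsum (Finset.range ((k + 1) ^ 2))
    fun i _ => (slowNullSeq_pos f (n i)).le
  have hcard : (Finset.range ((k + 1) ^ 2)).card • (1 / ((k : ℝ) + 1)) = k + 1 := by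
    rw [Finset.card_range, nsmul_eq_mul]
    push_cast
    field_simp
  have hkK : (K : ℝ) ≤ k := Nat.cast_le.2 hk
  linarith

/-- A null sequence has a modulus of convergence `f` such that every
sequence eventually dominating `f` picks out a summable subsequence. -/
theorem exists_summable_of_eventuallyDominates {r : ℕ → ℝ} (hpos : ∀ n, 0 < r n)
    (hr : Filter.Tendsto r Filter.atTop (nhds 0)) :
    ∃ f : ℕ → ℕ, ∀ n : ℕ → ℕ, EventuallyDominates n f → Summable fun i => r (n i) := by
  have hmod : ∀ k : ℕ, ∃ N, ∀ m ≥ N, r m < (1 / 2 : ℝ) ^ k := fun k =>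
    Filter.eventually_atTop.1 (hr.eventually_lt_const (by positivity))
  choose f hf using hmod
  refine ⟨f, fun n hn => ?_⟩
  refine summable_geometric_two.of_norm_bounded_eventually_nat ?_
  filter_upwards [hn] with i hi
  rw [Real.norm_of_nonneg (hpos _).le]
  exact (hf i _ hi).le

/-- `𝔟 = 𝔟₂`. -/
theorem stmt_2 : boundingNumber = b2 := by
  have hsub : { κ | ∃ F : Set (ℕ → ℕ), Cardinal.mk F = κ ∧
        ∀ g : ℕ → ℕ, ∃ f ∈ F, ¬ EventuallyDominates g f } ⊆
      { κ | ∃ (ι : Type) (r : ι → ℕ → ℝ), Cardinal.mk ι = κ ∧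
        (∀ ξ n, 0 < r ξ n) ∧
        (∀ ξ, Filter.Tendsto (r ξ) Filter.atTop (nhds 0)) ∧
        ¬ ∃ n : ℕ → ℕ, StrictMono n ∧ ∀ ξ, Summable (fun i => r ξ (n i)) } := by
    rintro κ ⟨F, hκ, hF⟩
    refine ⟨F, fun f => slowNullSeq f, hκ, fun f => slowNullSeq_pos f,
      fun f => tendsto_slowNullSeq f, ?_⟩
    rintro ⟨n, hn, hs⟩
    obtain ⟨f, hf, hnot⟩ := hF fun k => n ((k + 1) ^ 2)
    exact hnot (eventuallyDominates_of_summable_slowNullSeq hn (hs ⟨f, hf⟩))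
  have hne : { κ | ∃ F : Set (ℕ → ℕ), Cardinal.mk F = κ ∧
      ∀ g : ℕ → ℕ, ∃ f ∈ F, ¬ EventuallyDominates g f }.Nonempty := by
    refine ⟨_, Set.univ, rfl, fun g => ⟨fun k => g k + 1, Set.mem_univ _, fun h => ?_⟩⟩
    obtain ⟨k, hk⟩ := h.exists
    exact Nat.not_succ_le_self _ hk
  refine le_antisymm (le_csInf (hne.mono hsub) ?_) (csInf_le_csInf' hne hsub)
  rintro κ ⟨ι, r, rfl, hpos, hr, hbad⟩
  choose f hf using fun ξ => exists_summable_of_eventuallyDominates (hpos ξ) (hr ξ)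
  refine le_trans ?_ (Cardinal.mk_range_le (f := f))
  refine csInf_le' ⟨Set.range f, rfl, fun g => ?_⟩
  by_contra! hg
  refine hbad ⟨strictMajorant g, strictMono_strictMajorant g, fun ξ => hf ξ _ ?_⟩
  filter_upwards [hg (f ξ) ⟨ξ, rfl⟩] with k hk
  exact hk.trans (le_strictMajorant g k)
end

section
/- Let ι be an index type of cardinality strictly less than the bounding number 𝔟, and for each ξ ∈ ι let (r^ξ_n)_{n∈ℕ} be a sequence of strictly positive real numbers with lim_n r^ξ_n = 0. Then there exists a strictly increasing function g : ℕ → ℕ such that ∑_{i=1}^∞ r^ξ_{g(i)} < ∞ for every ξ ∈ ι. -/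
universe u

/-- A family of functions indexed by fewer than `𝔟` indices is eventually dominated by a single
function. -/
theorem exists_eventuallyDominates_of_lt_boundingNumber {ι : Type u}
    (hι : Cardinal.lift.{0} (Cardinal.mk ι) < Cardinal.lift.{u} boundingNumber)
    (f : ι → ℕ → ℕ) : ∃ h : ℕ → ℕ, ∀ ξ, EventuallyDominates h (f ξ) := by
  by_contra! hf
  have hle : boundingNumber ≤ Cardinal.mk (Set.range f) :=
    csInf_le' ⟨Set.range f, rfl, fun g => (hf g).elim fun ξ hξ => ⟨f ξ, ⟨ξ, rfl⟩, hξ⟩⟩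
  exact hι.not_ge ((Cardinal.lift_le.2 hle).trans Cardinal.mk_range_le_lift)

/-- Every function `ℕ → ℕ` is bounded above by a strictly increasing one. -/
theorem exists_strictMono_ge (h : ℕ → ℕ) : ∃ g : ℕ → ℕ, StrictMono g ∧ ∀ n, h n ≤ g n := by
  refine ⟨fun n => ∑ i ∈ Finset.range (n + 1), (h i + 1), strictMono_nat_of_lt_succ fun n => ?_,
    fun n => ?_⟩
  · simp only [Finset.sum_range_succ _ (n + 1)]
    omega
  · simp only [Finset.sum_range_succ _ n]
    omega

/-- Given fewer than `𝔟` strictly positive null sequences, there is a single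
strictly increasing `g : ℕ → ℕ` along which all of them have convergent subseries. -/
theorem stmt_3 {ι : Type u} (hι : Cardinal.lift.{0} (Cardinal.mk ι) < Cardinal.lift.{u} boundingNumber)
    (r : ι → ℕ → ℝ) (hpos : ∀ ξ n, 0 < r ξ n)
    (hnull : ∀ ξ, Filter.Tendsto (r ξ) Filter.atTop (nhds 0)) :
    ∃ g : ℕ → ℕ, StrictMono g ∧ ∀ ξ, Summable (fun i => r ξ (g i)) := by
  have hsmall : ∀ ξ k, ∃ N, ∀ n ≥ N, r ξ n < (1 / 2 : ℝ) ^ k := fun ξ k =>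
    Filter.eventually_atTop.1 ((hnull ξ).eventually_lt_const (by positivity))
  choose f hf using hsmall
  obtain ⟨h, hh⟩ := exists_eventuallyDominates_of_lt_boundingNumber hι f
  obtain ⟨g, hg, hhg⟩ := exists_strictMono_ge h
  refine ⟨g, hg, fun ξ => summable_geometric_two.of_norm_bounded_eventually_nat ?_⟩
  filter_upwards [hh ξ] with k hk
  rw [Real.norm_of_nonneg (hpos ξ _).le]
  exact (hf ξ k _ (hk.trans (hhg k))).le
end

section
/- Let A be a unital C*-algebra, let B ⊆ A be a unital C*-subalgebra (containing the unit of A) that is *-isomorphic to a full matrix algebra M_m(ℂ), let ε ≥ 0, and let x ∈ A satisfy ‖xu − ux‖ ≤ ε for every unitary u ∈ B. Then there exists y ∈ A such that yb = by for every b ∈ B and ‖y − x‖ ≤ ε. -/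
/-- The Weyl–Heisenberg element `∑ k, χ (b k) e_{k, k + a}` attached to a family `e` of
matrix units indexed by `ZMod m`, where `χ` is the standard additive character. -/
noncomputable def weylElement {A : Type*} [Ring A] [Algebra ℂ A] {m : ℕ} [NeZero m]
    (e : ZMod m → ZMod m → A) (a b : ZMod m) : A :=
  ∑ k, ZMod.stdAddChar (b * k) • e k (k + a)

section MatrixUnits

variable {A : Type*} [Ring A] [StarRing A] [Algebra ℂ A] [StarModule ℂ A]
  {m : ℕ} [NeZero m] {e : ZMod m → ZMod m → A}

lemma star_weylElement (hstar : ∀ i j, star (e i j) = e j i) (a b : ZMod m) :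
    star (weylElement e a b) = ∑ k, ZMod.stdAddChar (-(b * k)) • e (k + a) k := by
  simp [weylElement, star_sum, star_smul, hstar, AddChar.map_neg_eq_conj]

lemma weylElement_mem_unitary (hstar : ∀ i j, star (e i j) = e j i)
    (hmul : ∀ i j k l, e i j * e k l = if j = k then e i l else 0)
    (hone : ∑ i, e i i = 1) (a b : ZMod m) : weylElement e a b ∈ unitary A := by
  rw [Unitary.mem_iff, star_weylElement hstar, weylElement]
  constructor
  · have h : ∑ i, e (i + a) (i + a) = 1 :=
      (Equiv.sum_comp (Equiv.addRight a) fun i => e i i).trans hone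
    simp [Finset.sum_mul_sum, hmul, smul_smul, ← AddChar.map_add_eq_mul, h]
  · simp [Finset.sum_mul_sum, hmul, smul_smul, ← AddChar.map_add_eq_mul, hone]

/-- Twirling by the Weyl–Heisenberg unitaries in terms of matrix units. -/
lemma sum_weylElement_mul_mul_star (hstar : ∀ i j, star (e i j) = e j i) (x : A) :
    ∑ a, ∑ b, weylElement e a b * x * star (weylElement e a b) =
      (m : ℂ) • ∑ k, ∑ j, e k j * x * e j k := by
  have h (a : ZMod m) : ∑ b, weylElement e a b * x * star (weylElement e a b) =
      (m : ℂ) • ∑ k, e k (k + a) * x * e (k + a) k := by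
    have hb (b : ZMod m) : weylElement e a b * x * star (weylElement e a b) =
        ∑ k, ∑ l, (ZMod.stdAddChar (b * (k - l)) : ℂ) • (e k (k + a) * x * e (l + a) l) := by
      rw [star_weylElement hstar, weylElement, Finset.sum_mul, Finset.sum_mul_sum]
      simp only [smul_mul_assoc, mul_smul_comm, smul_smul, ← AddChar.map_add_eq_mul]
      refine Finset.sum_congr rfl fun k _ => Finset.sum_congr rfl fun l _ => ?_
      congr 2
      ring
    simp_rw [hb]
    rw [Finset.sum_comm, Finset.smul_sum]
    refine Finset.sum_congr rfl fun k _ => ?_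
    rw [Finset.sum_comm]
    simp_rw [← Finset.sum_smul,
      AddChar.sum_mulShift _ (ZMod.isPrimitive_stdAddChar m), sub_eq_zero]
    simp
  simp_rw [h]
  rw [← Finset.smul_sum, Finset.sum_comm]
  congr 1
  exact Finset.sum_congr rfl fun k _ =>
    Equiv.sum_comp (Equiv.addLeft k) fun j => e k j * x * e j k

end MatrixUnits

lemma commute_sum_matrixUnits {A n : Type*} [Ring A] [Fintype n] [DecidableEq n]
    {e : n → n → A} (hmul : ∀ i j k l, e i j * e k l = if j = k then e i l else 0)
    (x : A) (p q : n) : Commute (∑ k, ∑ j, e k j * x * e j k) (e p q) := by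
  simp [commute_iff_eq, Finset.sum_mul, Finset.mul_sum, mul_assoc, hmul, ← mul_assoc (e p q)]

/-- If `B` is a unital C*-subalgebra of `A` that is *-isomorphic to a full
matrix algebra, `ε ≥ 0`, and `x ∈ A` satisfies `‖xu − ux‖ ≤ ε` for every unitary `u ∈ B`,
then there is `y ∈ A` commuting with every element of `B` with `‖y − x‖ ≤ ε`. -/
theorem stmt_7 {A : Type*} [CStarAlgebra A] (B : StarSubalgebra ℂ A)
    (hB : ∃ m : ℕ, 0 < m ∧ Nonempty (B ≃⋆ₐ[ℂ] Matrix (Fin m) (Fin m) ℂ))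
    (ε : ℝ) (hε : 0 ≤ ε) (x : A)
    (hx : ∀ u : A, u ∈ B → u ∈ unitary A → ‖x * u - u * x‖ ≤ ε) :
    ∃ y : A, (∀ b ∈ B, y * b = b * y) ∧ ‖y - x‖ ≤ ε := by
  obtain ⟨m, hm, ⟨f⟩⟩ := hB
  have : NeZero m := ⟨hm.ne'⟩
  have hm0 : (m : ℂ) ≠ 0 := NeZero.ne _
  let ι : ZMod m ≃ Fin m := Fintype.equivOfCardEq (by simp [ZMod.card])
  let g : Matrix (Fin m) (Fin m) ℂ →⋆ₐ[ℂ] A := B.subtype.comp (f.symm : _ →⋆ₐ[ℂ] B)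
  have hgB (M) : g M ∈ B := (f.symm M).2
  let e (i j : ZMod m) : A := g (Matrix.single (ι i) (ι j) 1)
  have hstar (i j) : star (e i j) = e j i := by
    simp [e, ← map_star, Matrix.star_eq_conjTranspose, Matrix.conjTranspose_single]
  have hmul (i j k l) : e i j * e k l = if j = k then e i l else 0 := by
    simp only [e, ← map_mul]
    split_ifs with h
    · simp [h]
    · rw [Matrix.single_mul_single_of_ne _ _ _ _ (ι.injective.ne h), map_zero]
  have hone : ∑ i, e i i = 1 := by
    rw [Equiv.sum_comp ι fun i => g (Matrix.single i i 1), ← map_sum,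
      Matrix.sum_single_one, map_one]
  have heB (i j) : e i j ∈ B := hgB _
  let u (p : ZMod m × ZMod m) : A := weylElement e p.1 p.2
  have huU (p) : u p ∈ unitary A := weylElement_mem_unitary hstar hmul hone _ _
  have huB (p) : u p ∈ B := sum_mem fun k _ => B.smul_mem (heB _ _) _
  have hy : ((m : ℂ) ^ 2)⁻¹ • ∑ p, u p * x * star (u p) =
      (m : ℂ)⁻¹ • ∑ k, ∑ j, e k j * x * e j k := by
    rw [Fintype.sum_prod_type, sum_weylElement_mul_mul_star hstar, smul_smul]
    congr 1
    field_simp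
  refine ⟨((m : ℂ) ^ 2)⁻¹ • ∑ p, u p * x * star (u p), fun b hb => ?_, ?_⟩
  · rw [hy]
    have hbg : b = g (f ⟨b, hb⟩) := by simp [g]
    rw [hbg, Matrix.matrix_eq_sum_single (f ⟨b, hb⟩)]
    simp only [map_sum]
    refine Commute.sum_right _ _ _ fun i _ => Commute.sum_right _ _ _ fun j _ => ?_
    have hij : g (Matrix.single i j (f ⟨b, hb⟩ i j)) =
        f ⟨b, hb⟩ i j • e (ι.symm i) (ι.symm j) := by
      simp [e, ← map_smul, Matrix.smul_single]
    rw [hij]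
    exact ((commute_sum_matrixUnits hmul x _ _).smul_left _).smul_right _
  · have hdiff : ((m : ℂ) ^ 2)⁻¹ • ∑ p, u p * x * star (u p) - x =
        ((m : ℂ) ^ 2)⁻¹ • ∑ p, (u p * x - x * u p) * star (u p) := by
      simp only [sub_mul, mul_assoc, Unitary.mul_star_self_of_mem (huU _), mul_one,
        Finset.sum_sub_distrib, smul_sub]
      simp [← Nat.cast_smul_eq_nsmul ℂ, smul_smul, ← pow_two, hm0]
    have hterm (p) : ‖(u p * x - x * u p) * star (u p)‖ ≤ ε := by
      rw [CStarRing.norm_mul_mem_unitary _ (Unitary.star_mem (huU p)), norm_sub_rev]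
      exact hx _ (huB p) (huU p)
    rw [hdiff, norm_smul, norm_inv, norm_pow, Complex.norm_natCast, inv_mul_le_iff₀ (by positivity)]
    refine (norm_sum_le_of_le _ fun p _ => hterm p).trans_eq ?_
    simp [pow_two]
end

section
/- Let A be a unital C*-algebra, let D ⊆ A be a dense subset, and let (v_n)_{n∈ℕ} be a sequence of unitaries in A such that ∑_{n=1}^∞ ‖v_n a − a v_n‖ < ∞ for every a ∈ D. Set w_k = v_1 v_2 ⋯ v_k. Then for every a ∈ A the sequence (w_k a w_k*)_{k∈ℕ} converges in norm, and the map α : A → A defined by α(a) = lim_k w_k a w_k* is a unital isometric *-homomorphism (a unital *-endomorphism of A). -/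
open Filter Topology

/-- A sequence of isometries that is pointwise Cauchy on a dense set is pointwise Cauchy. -/
theorem cauchySeq_apply_of_isometry_of_dense {X Y : Type*} [PseudoMetricSpace X]
    [PseudoMetricSpace Y] {f : ℕ → X → Y} (hf : ∀ n, Isometry (f n)) {D : Set X} (hD : Dense D)
    (h : ∀ x ∈ D, CauchySeq fun n => f n x) (x : X) : CauchySeq fun n => f n x := by
  rw [Metric.cauchySeq_iff]
  intro ε hε
  obtain ⟨d, hd, hxd⟩ := hD.exists_dist_lt x (by positivity : 0 < ε / 3)
  obtain ⟨N, hN⟩ := Metric.cauchySeq_iff.1 (h d hd) (ε / 3) (by positivity)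
  refine ⟨N, fun m hm n hn => ?_⟩
  have h₁ : dist (f m x) (f m d) = dist x d := (hf m).dist_eq x d
  have h₂ : dist (f n d) (f n x) = dist x d := by rw [(hf n).dist_eq, dist_comm]
  linarith [hN m hm n hn, dist_triangle4 (f m x) (f m d) (f n d) (f n x)]

/-- The pointwise limit of a sequence of star algebra homomorphisms, as a star algebra
homomorphism. -/
def StarAlgHom.ofTendsto {R A B : Type*} [CommSemiring R] [Semiring A] [Algebra R A] [Star A]
    [Semiring B] [Algebra R B] [Star B] [TopologicalSpace B] [T2Space B] [ContinuousAdd B]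
    [ContinuousMul B] [ContinuousStar B] (φ : ℕ → A →⋆ₐ[R] B) (g : A → B)
    (h : ∀ a, Tendsto (fun n => φ n a) atTop (𝓝 (g a))) : A →⋆ₐ[R] B where
  toFun := g
  map_one' := tendsto_nhds_unique (h 1) (by simp)
  map_mul' a b := tendsto_nhds_unique (h (a * b)) (by simpa using (h a).mul (h b))
  map_zero' := tendsto_nhds_unique (h 0) (by simp)
  map_add' a b := tendsto_nhds_unique (h (a + b)) (by simpa using (h a).add (h b))
  commutes' r := tendsto_nhds_unique (h (algebraMap R A r)) (by simp [AlgHomClass.commutes])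
  map_star' a := tendsto_nhds_unique (h (star a)) (by simpa [map_star] using (h a).star)

/-- Conjugating by `w * u` instead of `w` moves `a` by the norm of the commutator of `u`
and `a`. -/
theorem dist_conj_mul_conj {A : Type*} [CStarAlgebra A] {w u : A} (hw : w ∈ unitary A)
    (hu : u ∈ unitary A) (a : A) :
    dist (w * a * star w) (w * u * a * star (w * u)) = ‖u * a - a * u‖ := by
  have key : w * u * a * star (w * u) - w * a * star w
      = w * ((u * a - a * u) * star u) * star w := by
    simp only [star_mul, mul_sub, sub_mul, mul_assoc]
    rw [← mul_assoc u (star u), Unitary.mul_star_self_of_mem hu, one_mul]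
  rw [dist_comm, dist_eq_norm, key, CStarRing.norm_mul_mem_unitary _ (Unitary.star_mem hw),
    CStarRing.norm_mem_unitary_mul _ hw, CStarRing.norm_mul_mem_unitary _ (Unitary.star_mem hu)]

/-- If `(v n)` are unitaries of a unital C*-algebra `A` such that
`∑ n, ‖v n • a − a • v n‖ < ∞` for all `a` in a dense set `D`, then with
`w k = v 0 * v 1 * ⋯ * v (k-1)`, the sequence `w k * a * (w k)*` converges in norm for
every `a ∈ A`, and the pointwise limit is a unital isometric *-homomorphism `A → A`. -/
theorem stmt_8 {A : Type*} [CStarAlgebra A] (D : Set A) (hD : Dense D)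
    (v : ℕ → A) (hv : ∀ n, v n ∈ unitary A)
    (hsum : ∀ a ∈ D, Summable fun n => ‖v n * a - a * v n‖) :
    ∃ α : A →⋆ₐ[ℂ] A, Isometry α ∧
      ∀ a : A, Filter.Tendsto
        (fun k => ((List.range k).map v).prod * a * star ((List.range k).map v).prod)
        Filter.atTop (nhds (α a)) := by
  have hw : ∀ k, ((List.range k).map v).prod ∈ unitary A := fun k =>
    list_prod_mem (by simpa using fun n _ => hv n)
  let φ : ℕ → A →⋆ₐ[ℂ] A := fun k => (Unitary.conjStarAlgAut ℂ A ⟨_, hw k⟩ : A →⋆ₐ[ℂ] A)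
  have hφ : ∀ k a, φ k a =
      ((List.range k).map v).prod * a * star ((List.range k).map v).prod := fun _ _ => rfl
  have hiso : ∀ k, Isometry (φ k) := fun k => AddMonoidHomClass.isometry_of_norm _ fun a => by
    rw [hφ, CStarRing.norm_mul_mem_unitary _ (Unitary.star_mem (hw k)),
      CStarRing.norm_mem_unitary_mul _ (hw k)]
  have hcauchy : ∀ a, CauchySeq fun k => φ k a :=
    cauchySeq_apply_of_isometry_of_dense hiso hD fun a ha =>
      cauchySeq_of_dist_le_of_summable _ (fun n => by
        rw [hφ, hφ, List.range_succ, List.map_append, List.prod_append, List.map_singleton,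
          List.prod_singleton, dist_conj_mul_conj (hw n) (hv n)]) (hsum a ha)
  choose g hg using fun a => cauchySeq_tendsto_of_complete (hcauchy a)
  refine ⟨StarAlgHom.ofTendsto φ g hg, Isometry.of_dist_eq fun a b => ?_, hg⟩
  exact tendsto_nhds_unique ((hg a).dist (hg b)) (by simp [(hiso _).dist_eq])
end

section
/- The bounding number 𝔟 equals 𝔟₁(LF), where 𝔟₁(LF) is the least cardinal κ for which there exist a unital locally finite dimensional (LF) C*-algebra A of density character κ and a central sequence of unitaries (u_n)_{n∈ℕ} in A such that for every strictly increasing sequence (n(i))_{i∈ℕ} of natural numbers, setting v_k = u_{n(1)} u_{n(2)} ⋯ u_{n(k)}, the sequence of inner automorphisms (Ad v_k)_{k∈ℕ} does not converge pointwise in norm on A. -/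
/-- The density character of a topological space: the least cardinality of a dense
subset. -/
noncomputable def densityCharacter (X : Type*) [TopologicalSpace X] : Cardinal :=
  sInf { κ | ∃ s : Set X, Dense s ∧ Cardinal.mk s = κ }

/-- A unital C*-algebra is locally finite dimensional (LF) if every finite subset can be
approximated arbitrarily well from a finite dimensional C*-subalgebra. -/
def IsLF (A : Type*) [CStarAlgebra A] : Prop :=
  ∀ (F : Finset A) (ε : ℝ), 0 < ε →
    ∃ M : StarSubalgebra ℂ A, FiniteDimensional ℂ M ∧
      ∀ a ∈ F, Metric.infDist a (M : Set A) < ε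

/-- A bounded sequence in a C*-algebra is central if it asymptotically commutes with
every element. -/
def IsCentralSequence {A : Type*} [CStarAlgebra A] (x : ℕ → A) : Prop :=
  (∃ C : ℝ, ∀ n, ‖x n‖ ≤ C) ∧
    ∀ a : A, Filter.Tendsto (fun n => ‖x n * a - a * x n‖) Filter.atTop (nhds 0)

/-- There is a central sequence of unitaries `(u n)` such that for every strictly
increasing sequence `n : ℕ → ℕ`, the inner automorphisms
`Ad (u (n 0) * ⋯ * u (n (k-1)))` do not converge pointwise in norm on `A`. -/
def HasBadCentralUnitaries (A : Type*) [CStarAlgebra A] : Prop :=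
  ∃ u : ℕ → A, (∀ k, u k ∈ unitary A) ∧ IsCentralSequence u ∧
    ∀ n : ℕ → ℕ, StrictMono n →
      ¬ ∀ a : A, ∃ L : A, Filter.Tendsto
        (fun k => ((List.range k).map (fun i => u (n i))).prod * a *
          star ((List.range k).map (fun i => u (n i))).prod)
        Filter.atTop (nhds L)

/-- The cardinal `𝔟₁(LF)`: as `𝔟₁`, but additionally requiring the algebra to be LF. -/
noncomputable def b1LF : Cardinal :=
  sInf { κ | ∃ (A : Type) (_ : CStarAlgebra A),
    IsLF A ∧ densityCharacter A = κ ∧ HasBadCentralUnitaries A }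

open Filter Topology Cardinal

theorem norm_conj_sub_conj_le {A : Type*} [CStarAlgebra A] {v w : A} (hv : v ∈ unitary A)
    (hw : w ∈ unitary A) (a b : A) :
    ‖v * a * star v - w * a * star w‖ ≤ ‖v * b * star v - w * b * star w‖ + 2 * ‖a - b‖ := by
  have h : ∀ x ∈ unitary A, ‖x * (a - b) * star x‖ = ‖a - b‖ := fun x hx => by
    rw [CStarRing.norm_mul_mem_unitary _ (Unitary.star_mem hx), CStarRing.norm_mem_unitary_mul _ hx]
  calc _ = ‖(v * b * star v - w * b * star w) +
        (v * (a - b) * star v - w * (a - b) * star w)‖ := by congr 1; noncomm_ring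
    _ ≤ ‖v * b * star v - w * b * star w‖ +
        (‖v * (a - b) * star v‖ + ‖w * (a - b) * star w‖) :=
      (norm_add_le _ _).trans (by gcongr; exact norm_sub_le _ _)
    _ = _ := by rw [h v hv, h w hw, two_mul]

theorem list_prod_mem_unitary {A : Type*} [CStarAlgebra A] {u : ℕ → A}
    (hu : ∀ k, u k ∈ unitary A) (n : ℕ → ℕ) (k : ℕ) :
    ((List.range k).map (fun i => u (n i))).prod ∈ unitary A :=
  list_prod_mem (by simp only [List.mem_map]; rintro _ ⟨i, -, rfl⟩; exact hu _)

theorem list_prod_range_succ {A : Type*} [Monoid A] (w : ℕ → A) (k : ℕ) :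
    ((List.range (k + 1)).map w).prod = ((List.range k).map w).prod * w k := by
  simp [List.range_succ]

/-- If the commutators of `a` with the factors are eventually bounded by a geometric sequence,
then the conjugates of `a` by the partial products form a Cauchy sequence. -/
theorem cauchySeq_conj_of_commutator_le {A : Type*} [CStarAlgebra A] {w : ℕ → A}
    (hw : ∀ k, w k ∈ unitary A) {a : A}
    (h : ∀ᶠ k in atTop, ‖w k * a - a * w k‖ ≤ (1 / 2 : ℝ) ^ k) :
    CauchySeq fun k => ((List.range k).map w).prod * a * star ((List.range k).map w).prod := by
  obtain ⟨N, hN⟩ := eventually_atTop.1 h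
  rw [← cauchySeq_shift N]
  refine cauchySeq_of_le_geometric (1 / 2) 1 (by norm_num) fun k => ?_
  set v := ((List.range (k + N)).map w).prod
  have hv : v ∈ unitary A := list_prod_mem_unitary hw id _
  have e : ((List.range (k + 1 + N)).map w).prod = v * w (k + N) := by
    rw [add_right_comm, list_prod_range_succ]
  have e2 : v * a * star v - v * w (k + N) * a * star (v * w (k + N))
      = v * ((a * w (k + N) - w (k + N) * a) * star (w (k + N))) * star v := by
    have := Unitary.mul_star_self_of_mem (hw (k + N))
    rw [star_mul, sub_mul, mul_assoc a, this]
    noncomm_ring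
  rw [dist_eq_norm, e, e2, CStarRing.norm_mul_mem_unitary _ (Unitary.star_mem hv),
      CStarRing.norm_mem_unitary_mul _ hv,
      CStarRing.norm_mul_mem_unitary _ (Unitary.star_mem (hw _)), norm_sub_rev, one_mul]
  exact (hN _ (by omega)).trans (pow_le_pow_of_le_one (by norm_num) (by norm_num) (by omega))

theorem exists_dense_mk_eq_densityCharacter (X : Type*) [TopologicalSpace X] :
    ∃ s : Set X, Dense s ∧ #s = densityCharacter X :=
  csInf_mem (s := { κ | ∃ s : Set X, Dense s ∧ #s = κ }) ⟨_, Set.univ, dense_univ, rfl⟩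

theorem exists_eventuallyDominates_of_lt {F : Set (ℕ → ℕ)} (hF : #F < boundingNumber) :
    ∃ g, ∀ f ∈ F, EventuallyDominates g f := by
  by_contra! h
  exact notMem_of_lt_csInf' hF ⟨F, rfl, h⟩

/-- In any unital C*-algebra with bad central unitaries, the density character is at least
the bounding number. -/
theorem boundingNumber_le_densityCharacter (A : Type) [CStarAlgebra A]
    (hA : HasBadCentralUnitaries A) : boundingNumber ≤ densityCharacter A := by
  by_contra! hlt
  obtain ⟨D, hD, hDc⟩ := exists_dense_mk_eq_densityCharacter A
  obtain ⟨u, hu, ⟨-, hc⟩, hbad⟩ := hA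
  have hf : ∀ a : A, ∀ m : ℕ, ∃ N, ∀ n ≥ N, ‖u n * a - a * u n‖ ≤ (1 / 2 : ℝ) ^ m := fun a m =>
    eventually_atTop.1 ((hc a).eventually_le_const (by positivity))
  choose f hf using hf
  obtain ⟨g, hg⟩ := exists_eventuallyDominates_of_lt (F := f '' D)
    (mk_image_le.trans_lt (hDc.trans_lt hlt))
  obtain ⟨n, hn, hgn⟩ : ∃ n : ℕ → ℕ, StrictMono n ∧ ∀ k, g k ≤ n k := by
    refine ⟨fun k => ∑ i ∈ Finset.range (k + 1), (g i + 1), ?_, fun k => ?_⟩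
    · exact strictMono_nat_of_lt_succ fun k => by simp [Finset.sum_range_succ _ (k + 1)]
    · simp only [Finset.sum_range_succ]; omega
  refine hbad n hn fun a => cauchySeq_tendsto_of_complete (Metric.cauchySeq_iff'.2 fun ε hε => ?_)
  obtain ⟨d, hdD, hd⟩ := hD.exists_dist_lt a (half_pos (half_pos hε))
  have hcd := cauchySeq_conj_of_commutator_le (w := fun i => u (n i)) (fun k => hu _) (a := d)
    ((hg _ ⟨d, hdD, rfl⟩).mono fun k hk => hf d k _ (hk.trans (hgn k)))
  obtain ⟨N, hN⟩ := Metric.cauchySeq_iff'.1 hcd _ (half_pos hε)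
  refine ⟨N, fun k hk => ?_⟩
  have h1 := hN k hk
  have uk := list_prod_mem_unitary hu n k
  have uN := list_prod_mem_unitary hu n N
  rw [dist_eq_norm] at hd h1 ⊢
  linarith [norm_conj_sub_conj_le uk uN a d]

theorem exists_unbounded_family :
    ∃ F : Set (ℕ → ℕ), #F = boundingNumber ∧
      ∀ g : ℕ → ℕ, ∃ f ∈ F, ¬ EventuallyDominates g f :=
  csInf_mem (s := { κ | ∃ F : Set (ℕ → ℕ), #F = κ ∧
    ∀ g : ℕ → ℕ, ∃ f ∈ F, ¬ EventuallyDominates g f })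
    ⟨_, Set.univ, rfl, fun g => ⟨fun n => g n + 1, trivial, fun h => by
      obtain ⟨n, hn⟩ := h.exists; exact absurd hn (by simp)⟩⟩

theorem aleph0_le_mk_of_unbounded {F : Set (ℕ → ℕ)}
    (hF : ∀ g : ℕ → ℕ, ∃ f ∈ F, ¬ EventuallyDominates g f) : ℵ₀ ≤ #F := by
  by_contra! h
  have hfin : F.Finite := lt_aleph0_iff_set_finite.1 h
  obtain ⟨f, hf, hn⟩ := hF fun n => ∑ f ∈ hfin.toFinset, f n
  exact hn (Eventually.of_forall fun n =>
    Finset.single_le_sum (f := fun f : ℕ → ℕ => f n) (fun _ _ => Nat.zero_le _)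
      (hfin.mem_toFinset.2 hf))

/-- Once `n` is exceeded by a value of `s`, `escapeIndex s n` is the first index at which this
happens; it is capped at `n + 1`. -/
noncomputable def escapeIndex (s : ℕ → ℕ) (n : ℕ) : ℕ :=
  sInf {j | n < s j ∨ n < j}

theorem escapeIndex_mem (s : ℕ → ℕ) (n : ℕ) :
    n < s (escapeIndex s n) ∨ n < escapeIndex s n :=
  Nat.sInf_mem (s := {j | n < s j ∨ n < j}) ⟨n + 1, Or.inr n.lt_succ_self⟩

theorem escapeIndex_le_succ (s : ℕ → ℕ) (n : ℕ) : escapeIndex s n ≤ n + 1 :=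
  Nat.sInf_le (Or.inr n.lt_succ_self)

theorem escapeIndex_le {s : ℕ → ℕ} {n j : ℕ} (h : n < s j) : escapeIndex s n ≤ j :=
  Nat.sInf_le (Or.inl h)

theorem escapeIndex_mono (s : ℕ → ℕ) : Monotone (escapeIndex s) := fun _ n hmn =>
  Nat.sInf_le ((escapeIndex_mem s n).imp hmn.trans_lt hmn.trans_lt)

theorem tendsto_escapeIndex (s : ℕ → ℕ) : Tendsto (escapeIndex s) atTop atTop := by
  refine tendsto_atTop.2 fun J => ?_
  filter_upwards [(Finset.range J).eventually_all.2 fun j _ =>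
    (eventually_ge_atTop (s j)).and (eventually_ge_atTop j)] with n hn
  by_contra! h
  have h1 := hn _ (Finset.mem_range.2 h)
  have := escapeIndex_mem s n
  omega

/-- The angle `1 / (escapeIndex s n + 1)`, which tends to zero as `n` grows. -/
noncomputable def escapeAngle (s : ℕ → ℕ) (n : ℕ) : ℝ := 1 / ((escapeIndex s n : ℝ) + 1)

theorem tendsto_escapeAngle (s : ℕ → ℕ) : Tendsto (escapeAngle s) atTop (𝓝 0) :=
  tendsto_one_div_add_atTop_nhds_zero_nat.comp (tendsto_escapeIndex s)

/-- A unimodular product does not converge when its angles are infinitely often bounded below by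
the reciprocal of the number of factors. -/
theorem not_tendsto_prod_exp {θ : ℕ → ℝ} (h0 : ∀ i, 0 ≤ θ i) (h1 : ∀ i, θ i ≤ 1)
    (h : ∃ᶠ i : ℕ in atTop, ∀ j ≤ i, 1 / ((i : ℝ) + 1) ≤ θ j) (L : ℂ) :
    ¬ Tendsto (fun k => ∏ i ∈ Finset.range k, Complex.exp (θ i * Complex.I)) atTop (𝓝 L) := by
  intro hL
  obtain ⟨N, hN⟩ := Metric.cauchySeq_iff'.1 hL.cauchySeq (1 / 4) (by norm_num)
  have key : ∀ k, ∑ i ∈ Finset.range k, θ (N + i) < 1 / 2 := by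
    intro k
    induction k with
    | zero => norm_num
    | succ k ih =>
      have hd := hN (N + (k + 1)) (by omega)
      rw [dist_eq_norm, Finset.prod_range_add, ← mul_sub_one, norm_mul, ← Complex.exp_sum,
        ← Finset.sum_mul, ← Complex.ofReal_sum, Complex.norm_exp_ofReal_mul_I, one_mul,
        ← Complex.exp_sum, ← Finset.sum_mul, ← Complex.ofReal_sum] at hd
      set S := ∑ i ∈ Finset.range (k + 1), θ (N + i) with hS
      have hS0 : 0 ≤ S := Finset.sum_nonneg fun _ _ => h0 _
      have hS1 : S ≤ 3 / 2 := by
        rw [hS, Finset.sum_range_succ]; linarith [h1 (N + k)]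
      have him := (Complex.abs_im_le_norm _).trans_lt hd
      rw [Complex.sub_im, Complex.exp_ofReal_mul_I_im, Complex.one_im, sub_zero] at him
      have hsin := Real.mul_le_sin hS0 (by linarith [Real.pi_gt_three])
      have h4 : 2 / Real.pi * S < 1 / 4 := hsin.trans_lt ((le_abs_self _).trans_lt him)
      rw [div_mul_eq_mul_div, div_lt_iff₀ Real.pi_pos] at h4
      linarith [Real.pi_lt_four]
  obtain ⟨i, hi, hθ⟩ := (h.and_eventually (eventually_ge_atTop (2 * N))).exists.imp
    fun i hi => hi.symm
  have hk := key (i + 1 - N)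
  have hle : ((i + 1 - N : ℕ) : ℝ) * (1 / ((i : ℝ) + 1)) ≤
      ∑ j ∈ Finset.range (i + 1 - N), θ (N + j) := by
    rw [← nsmul_eq_mul]
    simpa using Finset.card_nsmul_le_sum (Finset.range (i + 1 - N)) (fun j => θ (N + j)) _
      fun j hj => hθ _ (by have := Finset.mem_range.1 hj; omega)
  have hlt := hle.trans_lt hk
  rw [mul_one_div, div_lt_iff₀ (by positivity), Nat.cast_sub (by omega)] at hlt
  have : (2 * N : ℝ) ≤ i := by exact_mod_cast hi
  push_cast at hlt
  linarith

section DirectedUnion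

variable {C : Type*} [CStarAlgebra C] {J : Type*} {M : J → StarSubalgebra ℂ C}

theorem exists_mem_dist_lt_of_directed [Nonempty J] (hM : Directed (· ≤ ·) M) {x : C}
    (hx : x ∈ (⨆ j, M j).topologicalClosure) {ε : ℝ} (hε : 0 < ε) :
    ∃ j, ∃ y ∈ M j, dist x y < ε := by
  rw [← SetLike.mem_coe, StarSubalgebra.topologicalClosure_coe,
    StarSubalgebra.coe_iSup_of_directed hM] at hx
  obtain ⟨y, hy, hxy⟩ := Metric.mem_closure_iff.1 hx ε hε
  obtain ⟨j, hj⟩ := Set.mem_iUnion.1 hy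
  exact ⟨j, y, hj, hxy⟩

theorem le_topologicalClosure_iSup (j : J) : M j ≤ (⨆ j, M j).topologicalClosure :=
  (le_iSup M j).trans (StarSubalgebra.le_topologicalClosure _)

instance : IsClosed ((⨆ j, M j).topologicalClosure : Set C) :=
  StarSubalgebra.isClosed_topologicalClosure _

theorem isLF_of_directed [Nonempty J] (hM : Directed (· ≤ ·) M)
    (hfd : ∀ j, FiniteDimensional ℂ (M j)) :
    IsLF (⨆ j, M j).topologicalClosure := by
  classical
  intro F ε hε
  have h := fun x : (⨆ j, M j).topologicalClosure =>
    exists_mem_dist_lt_of_directed hM x.2 hε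
  choose j y hy hxy using h
  obtain ⟨i, hi⟩ := hM.finset_le (F.image j)
  refine ⟨(M i).comap (StarSubalgebra.subtype _), ?_, fun a ha => ?_⟩
  · have := hfd i
    let φ : ((M i).comap (StarSubalgebra.subtype (⨆ j, M j).topologicalClosure)) →ₗ[ℂ] M i :=
      { toFun := fun x => ⟨x.1.1, x.2⟩
        map_add' := fun _ _ => rfl
        map_smul' := fun _ _ => rfl }
    exact FiniteDimensional.of_injective φ fun x x' h =>
      Subtype.ext (Subtype.ext (congrArg (fun y : M i => (y : C)) h))
  · have hyi : y a ∈ M i := hi (j a) (Finset.mem_image_of_mem _ ha) (hy a)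
    exact (Metric.infDist_le_dist_of_mem
      (show (⟨y a, le_topologicalClosure_iSup i hyi⟩ : (⨆ j, M j).topologicalClosure) ∈ _
        from hyi)).trans_lt (hxy a)

end DirectedUnion

theorem densityCharacter_le_of_directed {C : Type} [CStarAlgebra C] {J : Type} [Nonempty J]
    {M : J → StarSubalgebra ℂ C} (hM : Directed (· ≤ ·) M)
    (hfd : ∀ j, FiniteDimensional ℂ (M j)) {κ : Cardinal} (hκ : ℵ₀ ≤ κ) (hJ : #J ≤ κ) :
    densityCharacter (⨆ j, M j).topologicalClosure ≤ κ := by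
  have hsep : ∀ j, ∃ D : Set (M j), D.Countable ∧ Dense D := fun j => by
    have := hfd j
    have : ProperSpace (M j) := FiniteDimensional.proper ℂ (M j)
    exact TopologicalSpace.exists_countable_dense _
  choose D hDc hD using hsep
  let s : Set (⨆ j, M j).topologicalClosure :=
    ⋃ j, (fun x : M j => ⟨x, le_topologicalClosure_iSup j x.2⟩) '' D j
  have hs : Dense s := Metric.dense_iff.2 fun x ε hε => by
    obtain ⟨j, y, hy, hxy⟩ := exists_mem_dist_lt_of_directed hM x.2 (half_pos hε)
    obtain ⟨z, hz, hyz⟩ := (hD j).exists_dist_lt ⟨y, hy⟩ (half_pos hε)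
    refine ⟨⟨z, le_topologicalClosure_iSup j z.2⟩, ?_, Set.mem_iUnion.2 ⟨j, z, hz, rfl⟩⟩
    rw [Metric.mem_ball, dist_comm]
    have := dist_triangle (x : C) y z
    change dist (x : C) z < ε
    change dist y (z : C) < ε / 2 at hyz
    linarith
  calc densityCharacter _ ≤ #s := csInf_le' ⟨s, hs, rfl⟩
    _ ≤ #J * ⨆ j, #((fun x : M j => (⟨x, le_topologicalClosure_iSup j x.2⟩ :
          (⨆ j, M j).topologicalClosure)) '' D j) := mk_iUnion_le _
    _ ≤ κ * ℵ₀ := mul_le_mul' hJ (ciSup_le' fun j => ((hDc j).image _).le_aleph0)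
    _ = κ := mul_aleph0_eq hκ

open scoped Matrix.Norms.L2Operator BoundedContinuousFunction ComplexConjugate

/-- The commutative algebra of diagonal two by two matrices. -/
def diagonalStarSubalgebra : StarSubalgebra ℂ (Matrix (Fin 2) (Fin 2) ℂ) where
  carrier := Set.range Matrix.diagonal
  mul_mem' := by
    rintro _ _ ⟨a, rfl⟩ ⟨b, rfl⟩
    exact ⟨_, (Matrix.diagonal_mul_diagonal' _ _).symm⟩
  add_mem' := by
    rintro _ _ ⟨a, rfl⟩ ⟨b, rfl⟩
    exact ⟨_, (Matrix.diagonal_add _ _).symm⟩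
  algebraMap_mem' r := ⟨fun _ => r, rfl⟩
  star_mem' := by
    rintro _ ⟨a, rfl⟩
    exact ⟨star a, (Matrix.diagonal_conjTranspose _).symm⟩

theorem mul_comm_of_mem_diagonal {x y : Matrix (Fin 2) (Fin 2) ℂ}
    (hx : x ∈ diagonalStarSubalgebra) (hy : y ∈ diagonalStarSubalgebra) : x * y = y * x := by
  obtain ⟨a, rfl⟩ := hx
  obtain ⟨b, rfl⟩ := hy
  exact (Matrix.commute_diagonal a b).eq

/-- The matrix `diag(1, z)`. -/
def phaseMatrix (z : ℂ) : Matrix (Fin 2) (Fin 2) ℂ := Matrix.diagonal ![1, z]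

theorem phaseMatrix_one : phaseMatrix 1 = 1 := by
  rw [phaseMatrix, ← Matrix.diagonal_one]
  congr 1; ext i; fin_cases i <;> rfl

theorem phaseMatrix_mul (z w : ℂ) : phaseMatrix z * phaseMatrix w = phaseMatrix (z * w) := by
  rw [phaseMatrix, phaseMatrix, phaseMatrix, Matrix.diagonal_mul_diagonal]
  congr 1; ext i; fin_cases i <;> simp

theorem star_phaseMatrix (z : ℂ) : star (phaseMatrix z) = phaseMatrix (conj z) := by
  rw [phaseMatrix, phaseMatrix, Matrix.star_eq_conjTranspose, Matrix.diagonal_conjTranspose]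
  congr 1; ext i; fin_cases i <;> simp

theorem phaseMatrix_mem_diagonal (z : ℂ) : phaseMatrix z ∈ diagonalStarSubalgebra := ⟨_, rfl⟩

theorem continuous_phaseMatrix : Continuous phaseMatrix := by
  refine Continuous.matrix_diagonal (continuous_pi fun i => ?_)
  fin_cases i
  · exact continuous_const
  · exact continuous_id

theorem phaseMatrix_mem_unitary {z : ℂ} (hz : ‖z‖ = 1) :
    phaseMatrix z ∈ unitary (Matrix (Fin 2) (Fin 2) ℂ) := by
  have h : z * conj z = 1 := by rw [Complex.mul_conj, Complex.normSq_eq_norm_sq, hz]; simp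
  rw [Unitary.mem_iff, star_phaseMatrix, phaseMatrix_mul, phaseMatrix_mul, mul_comm, h]
  exact ⟨phaseMatrix_one, phaseMatrix_one⟩

theorem phaseMatrix_conj_apply (z : ℂ) :
    (phaseMatrix z * Matrix.single 0 1 1 * star (phaseMatrix z) : Matrix (Fin 2) (Fin 2) ℂ) 0 1 = conj z := by
  simp [phaseMatrix, Matrix.mul_apply, Fin.sum_univ_two, Matrix.single]

section Construction

variable {ι : Type*} [TopologicalSpace ι]

/-- Bounded families of matrices which, off the finite set `j.1`, are diagonal and
depend only on the values of the first `j.2 + 1` functions `c 0, …, c j.2`. -/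
def tailSubalgebra (c : ℕ → ι → ℕ) (j : Finset ι × ℕ) :
    StarSubalgebra ℂ (ι →ᵇ Matrix (Fin 2) (Fin 2) ℂ) where
  carrier := {x | (∀ i ∉ j.1, x i ∈ diagonalStarSubalgebra) ∧
    ∀ i ∉ j.1, ∀ i' ∉ j.1, (∀ m ≤ j.2, c m i = c m i') → x i = x i'}
  mul_mem' {x y} hx hy := ⟨fun i hi => mul_mem (hx.1 i hi) (hy.1 i hi), fun i hi i' hi' h => by
    simp [hx.2 i hi i' hi' h, hy.2 i hi i' hi' h]⟩
  add_mem' {x y} hx hy := ⟨fun i hi => add_mem (hx.1 i hi) (hy.1 i hi), fun i hi i' hi' h => by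
    simp [hx.2 i hi i' hi' h, hy.2 i hi i' hi' h]⟩
  algebraMap_mem' r := ⟨fun i _ => diagonalStarSubalgebra.algebraMap_mem r,
    fun _ _ _ _ _ => rfl⟩
  star_mem' {x} hx := ⟨fun i hi => star_mem (hx.1 i hi), fun i hi i' hi' h => by
    simp [hx.2 i hi i' hi' h]⟩

theorem tailSubalgebra_mono (c : ℕ → ι → ℕ) : Monotone (tailSubalgebra c) := by
  intro j k hjk x hx
  have hS : ∀ i ∉ k.1, i ∉ j.1 := fun i hi h => hi (hjk.1 h)
  exact ⟨fun i hi => hx.1 i (hS i hi), fun i hi i' hi' h =>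
    hx.2 i (hS i hi) i' (hS i' hi') fun m hm => h m (hm.trans hjk.2)⟩

theorem finiteDimensional_tailSubalgebra {c : ℕ → ι → ℕ} (hc : ∀ m i, c m i ≤ m + 1)
    (j : Finset ι × ℕ) : FiniteDimensional ℂ (tailSubalgebra c j) := by
  classical
  let q : {i // i ∉ j.1} → (Fin (j.2 + 1) → Fin (j.2 + 2)) := fun i m =>
    ⟨c m i, by have := hc m i; omega⟩
  let φ : tailSubalgebra c j →ₗ[ℂ]
      (j.1 → Matrix (Fin 2) (Fin 2) ℂ) × (Set.range q → Matrix (Fin 2) (Fin 2) ℂ) :=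
    { toFun := fun x => (fun i => x.1 i, fun t => x.1 t.2.choose)
      map_add' := fun _ _ => rfl
      map_smul' := fun _ _ => rfl }
  refine FiniteDimensional.of_injective φ fun x y h => Subtype.ext (DFunLike.ext _ _ fun i => ?_)
  by_cases hi : i ∈ j.1
  · exact congrFun (congrArg Prod.fst h) ⟨i, hi⟩
  · have ht : q ⟨i, hi⟩ ∈ Set.range q := ⟨_, rfl⟩
    have hv : ∀ m ≤ j.2, c m i = c m ht.choose := fun m hm =>
      (congrArg Fin.val (congrFun ht.choose_spec ⟨m, by omega⟩)).symm
    rw [x.2.2 i hi _ ht.choose.2 hv, y.2.2 i hi _ ht.choose.2 hv]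
    exact congrFun (congrArg Prod.snd h) ⟨_, ht⟩

variable [DiscreteTopology ι]

/-- The phase of the `n`-th unitary at the coordinate belonging to the function `s`. -/
noncomputable def escapePhase (s : ℕ → ℕ) (n : ℕ) : ℂ :=
  Complex.exp (escapeAngle s n * Complex.I)

theorem norm_escapePhase (s : ℕ → ℕ) (n : ℕ) : ‖escapePhase s n‖ = 1 :=
  Complex.norm_exp_ofReal_mul_I _

theorem tendsto_escapePhase (s : ℕ → ℕ) : Tendsto (escapePhase s) atTop (𝓝 1) := by
  have h : Continuous fun θ : ℝ => Complex.exp (θ * Complex.I) := by fun_prop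
  have h1 := (h.tendsto 0).comp (tendsto_escapeAngle s)
  rwa [Complex.ofReal_zero, zero_mul, Complex.exp_zero] at h1

/-- The unitary with value `diag(1, escapePhase (s i) n)` at the coordinate `i`. -/
noncomputable def escapeUnitary (s : ι → ℕ → ℕ) (n : ℕ) : ι →ᵇ Matrix (Fin 2) (Fin 2) ℂ :=
  BoundedContinuousFunction.ofNormedAddCommGroupDiscrete
    (fun i => phaseMatrix (escapePhase (s i) n)) 1 fun _ =>
      (CStarRing.norm_of_mem_unitary (phaseMatrix_mem_unitary (norm_escapePhase _ _))).le

theorem escapeUnitary_apply (s : ι → ℕ → ℕ) (n : ℕ) (i : ι) :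
    escapeUnitary s n i = phaseMatrix (escapePhase (s i) n) := rfl

theorem escapeUnitary_mem_unitary (s : ι → ℕ → ℕ) (n : ℕ) :
    escapeUnitary s n ∈ unitary (ι →ᵇ Matrix (Fin 2) (Fin 2) ℂ) :=
  Unitary.mem_iff.2
    ⟨DFunLike.ext _ _ fun _ =>
      Unitary.star_mul_self_of_mem (phaseMatrix_mem_unitary (norm_escapePhase _ _)),
    DFunLike.ext _ _ fun _ =>
      Unitary.mul_star_self_of_mem (phaseMatrix_mem_unitary (norm_escapePhase _ _))⟩

theorem escapeUnitary_mem_tailSubalgebra (s : ι → ℕ → ℕ) (n : ℕ) :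
    escapeUnitary s n ∈ tailSubalgebra (fun m i => escapeIndex (s i) m) (∅, n) :=
  ⟨fun _ _ => phaseMatrix_mem_diagonal _, fun i _ i' _ h => by
    have := h n le_rfl
    simp only [escapeUnitary_apply, escapePhase, escapeAngle, this]⟩

theorem tendsto_commutator_escapeUnitary (s : ι → ℕ → ℕ) {c : ℕ → ι → ℕ} {j : Finset ι × ℕ}
    {a : ι →ᵇ Matrix (Fin 2) (Fin 2) ℂ} (ha : a ∈ tailSubalgebra c j) :
    Tendsto (fun n => ‖escapeUnitary s n * a - a * escapeUnitary s n‖) atTop (𝓝 0) := by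
  classical
  have hle : ∀ n, ‖escapeUnitary s n * a - a * escapeUnitary s n‖ ≤
      ∑ i ∈ j.1, ‖phaseMatrix (escapePhase (s i) n) * a i -
        a i * phaseMatrix (escapePhase (s i) n)‖ := fun n => by
    refine (BoundedContinuousFunction.norm_le (Finset.sum_nonneg fun _ _ => norm_nonneg _)).2
      fun i => ?_
    simp only [BoundedContinuousFunction.coe_sub, BoundedContinuousFunction.coe_mul, Pi.sub_apply,
      Pi.mul_apply, escapeUnitary_apply]
    by_cases hi : i ∈ j.1
    · exact Finset.single_le_sum (f := fun i => ‖phaseMatrix (escapePhase (s i) n) * a i -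
        a i * phaseMatrix (escapePhase (s i) n)‖) (fun _ _ => norm_nonneg _) hi
    · rw [mul_comm_of_mem_diagonal (phaseMatrix_mem_diagonal _) (ha.1 i hi), sub_self, norm_zero]
      exact Finset.sum_nonneg fun _ _ => norm_nonneg _
  refine squeeze_zero (fun _ => norm_nonneg _) hle ?_
  rw [← Finset.sum_const_zero (s := j.1)]
  refine tendsto_finsetSum _ fun i _ => ?_
  have hw : Tendsto (fun n => phaseMatrix (escapePhase (s i) n)) atTop (𝓝 1) := by
    rw [← phaseMatrix_one]
    exact (continuous_phaseMatrix.tendsto 1).comp (tendsto_escapePhase (s i))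
  simpa using ((hw.mul_const (a i)).sub (hw.const_mul (a i))).norm

theorem prod_escapeUnitary_apply (s : ι → ℕ → ℕ) (n : ℕ → ℕ) (k : ℕ) (i : ι) :
    ((List.range k).map fun l => escapeUnitary s (n l)).prod i =
      phaseMatrix (∏ l ∈ Finset.range k, escapePhase (s i) (n l)) := by
  induction k with
  | zero => simp [phaseMatrix_one]
  | succ k ih =>
    rw [list_prod_range_succ, BoundedContinuousFunction.mul_apply, ih, escapeUnitary_apply,
      phaseMatrix_mul, Finset.prod_range_succ]

/-- The matrix unit `e₀₁` placed at the coordinate `i`. -/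
noncomputable def matrixUnitAt [DecidableEq ι] (i : ι) : ι →ᵇ Matrix (Fin 2) (Fin 2) ℂ :=
  BoundedContinuousFunction.ofNormedAddCommGroupDiscrete
    (Pi.single i (Matrix.single 0 1 1)) ‖(Matrix.single 0 1 1 : Matrix (Fin 2) (Fin 2) ℂ)‖
    fun i' => by
      by_cases h : i' = i
      · subst h; simp
      · simp [h]

theorem matrixUnitAt_mem_tailSubalgebra [DecidableEq ι] (c : ℕ → ι → ℕ) (i : ι) :
    matrixUnitAt i ∈ tailSubalgebra c ({i}, 0) := by
  have h : ∀ i' ∉ ({i} : Finset ι), matrixUnitAt i i' = 0 := fun i' hi' =>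
    Pi.single_eq_of_ne (by simpa using hi') _
  exact ⟨fun i' hi' => by rw [h i' hi']; exact zero_mem _,
    fun i' hi' i'' hi'' _ => by rw [h i' hi', h i'' hi'']⟩

theorem not_tendsto_prod_escapePhase {s : ℕ → ℕ} {n : ℕ → ℕ} (hn : StrictMono n)
    (hs : ¬ EventuallyDominates n s) (L : ℂ) :
    ¬ Tendsto (fun k => ∏ l ∈ Finset.range k, escapePhase s (n l)) atTop (𝓝 L) := by
  refine not_tendsto_prod_exp (θ := fun l => escapeAngle s (n l)) (fun l => ?_) (fun l => ?_) ?_ L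
  · simp only [escapeAngle]; positivity
  · simp only [escapeAngle]
    rw [div_le_one (by positivity)]
    linarith [(Nat.cast_nonneg (escapeIndex s (n l)) : (0 : ℝ) ≤ _)]
  · refine (not_eventually.1 hs).mono fun i hi l hl => ?_
    have hle : escapeIndex s (n l) ≤ i :=
      (escapeIndex_mono s (hn.monotone hl)).trans (escapeIndex_le (not_le.1 hi))
    simp only [escapeAngle]
    gcongr

/-- The closure of the union of the algebras `tailSubalgebra` given by the escape indices. -/
noncomputable abbrev escapeAlgebra (s : ι → ℕ → ℕ) :
    StarSubalgebra ℂ (ι →ᵇ Matrix (Fin 2) (Fin 2) ℂ) :=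
  (⨆ j, tailSubalgebra (fun m i => escapeIndex (s i) m) j).topologicalClosure

theorem hasBadCentralUnitaries_escapeAlgebra (s : ι → ℕ → ℕ)
    (hs : ∀ g, ∃ i, ¬ EventuallyDominates g (s i)) :
    HasBadCentralUnitaries (escapeAlgebra s) := by
  classical
  let u : ℕ → escapeAlgebra s := fun n =>
    ⟨escapeUnitary s n, le_topologicalClosure_iSup _ (escapeUnitary_mem_tailSubalgebra s n)⟩
  have hu : ∀ n, u n ∈ unitary (escapeAlgebra s) := fun n => Unitary.mem_iff.2
    ⟨Subtype.ext (Unitary.star_mul_self_of_mem (escapeUnitary_mem_unitary s n)),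
      Subtype.ext (Unitary.mul_star_self_of_mem (escapeUnitary_mem_unitary s n))⟩
  have hnorm : ∀ n, ‖escapeUnitary s n‖ ≤ 1 := fun n =>
    (BoundedContinuousFunction.norm_le zero_le_one).2 fun _ =>
      (CStarRing.norm_of_mem_unitary (phaseMatrix_mem_unitary (norm_escapePhase _ _))).le
  refine ⟨u, hu, ⟨⟨1, hnorm⟩, fun a => ?_⟩, fun n hn hconv => ?_⟩
  · refine Metric.tendsto_atTop'.2 fun ε hε => ?_
    obtain ⟨j, b, hb, hab⟩ :=
      exists_mem_dist_lt_of_directed (tailSubalgebra_mono _).directed_le a.2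
        (half_pos (half_pos hε))
    obtain ⟨N, hN⟩ := eventually_atTop.1
      ((tendsto_commutator_escapeUnitary s hb).eventually_lt_const (half_pos hε))
    refine ⟨N, fun n hn => ?_⟩
    rw [Real.dist_eq, sub_zero, abs_norm]
    change ‖escapeUnitary s n * a.1 - a.1 * escapeUnitary s n‖ < ε
    rw [dist_eq_norm] at hab
    calc _ = ‖(escapeUnitary s n * b - b * escapeUnitary s n) +
          (escapeUnitary s n * (a.1 - b) - (a.1 - b) * escapeUnitary s n)‖ := by
          congr 1; noncomm_ring
      _ ≤ ‖escapeUnitary s n * b - b * escapeUnitary s n‖ +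
          (‖escapeUnitary s n‖ * ‖a.1 - b‖ + ‖a.1 - b‖ * ‖escapeUnitary s n‖) :=
        (norm_add_le _ _).trans (add_le_add_right ((norm_sub_le _ _).trans
          (add_le_add (norm_mul_le _ _) (norm_mul_le _ _))) _)
      _ < ε := by
        have := hN n hn.le
        nlinarith [hnorm n, norm_nonneg (a.1 - b)]
  · obtain ⟨i, hi⟩ := hs n
    obtain ⟨L, hL⟩ := hconv ⟨matrixUnitAt i,
      le_topologicalClosure_iSup _ (matrixUnitAt_mem_tailSubalgebra _ i)⟩
    have hcont : Continuous fun x : escapeAlgebra s => conj (x.1 i 0 1) := by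
      have h1 : Continuous fun x : escapeAlgebra s => x.1 i :=
        (continuous_eval_const i).comp continuous_subtype_val
      exact Complex.continuous_conj.comp (h1.matrix_elem 0 1)
    refine not_tendsto_prod_escapePhase hn hi _ (((hcont.tendsto L).comp hL).congr fun k => ?_)
    have hprod : ((((List.range k).map fun l => u (n l)).prod : escapeAlgebra s) :
        ι →ᵇ Matrix (Fin 2) (Fin 2) ℂ) =
        ((List.range k).map fun l => escapeUnitary s (n l)).prod := by
      rw [← StarSubalgebra.coe_subtype, map_list_prod, List.map_map]
      rfl
    have hval : matrixUnitAt i i = Matrix.single 0 1 1 := Pi.single_eq_same i _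
    simp only [Function.comp_apply, MulMemClass.coe_mul, StarMemClass.coe_star, hprod,
      BoundedContinuousFunction.mul_apply, BoundedContinuousFunction.star_apply,
      prod_escapeUnitary_apply, hval, phaseMatrix_conj_apply, Complex.conj_conj]

end Construction

/-- An unbounded family of minimal size yields an LF algebra with bad central unitaries. -/
theorem exists_isLF_densityCharacter_le_boundingNumber :
    ∃ (A : Type) (_ : CStarAlgebra A),
      IsLF A ∧ densityCharacter A ≤ boundingNumber ∧ HasBadCentralUnitaries A := by
  classical
  obtain ⟨F, hF, hunb⟩ := exists_unbounded_family
  have hinf := aleph0_le_mk_of_unbounded hunb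
  let _ : TopologicalSpace F := ⊥
  have : DiscreteTopology F := ⟨rfl⟩
  let s : F → ℕ → ℕ := Subtype.val
  have hdir := (tailSubalgebra_mono fun m i => escapeIndex (s i) m).directed_le
  have hfd := finiteDimensional_tailSubalgebra fun m i => escapeIndex_le_succ (s i) m
  have hbad := hasBadCentralUnitaries_escapeAlgebra s fun g =>
    let ⟨f, hf, h⟩ := hunb g
    ⟨⟨f, hf⟩, h⟩
  have hJ : #(Finset F × ℕ) ≤ #F := by
    have : Infinite F := infinite_iff.2 hinf
    rw [mk_prod, lift_id, lift_id, mk_finset_of_infinite, mk_nat, mul_aleph0_eq hinf]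
  rw [← hF]
  exact ⟨escapeAlgebra s, inferInstance, isLF_of_directed hdir hfd,
    densityCharacter_le_of_directed hdir hfd hinf hJ, hbad⟩

/-- `𝔟 = 𝔟₁(LF)`. -/
theorem stmt_11 : boundingNumber = b1LF := by
  obtain ⟨A, hA, hLF, hd, hbad⟩ := exists_isLF_densityCharacter_le_boundingNumber
  have hmem : densityCharacter A ∈ { κ | ∃ (A : Type) (_ : CStarAlgebra A),
      IsLF A ∧ densityCharacter A = κ ∧ HasBadCentralUnitaries A } :=
    ⟨A, hA, hLF, rfl, hbad⟩
  refine le_antisymm (le_csInf ⟨_, hmem⟩ ?_) ((csInf_le' hmem).trans hd)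
  rintro _ ⟨A', _, -, rfl, hA'⟩
  exact boundingNumber_le_densityCharacter A' hA'
end

section
/- Let A be a unital locally matricial (LM) C*-algebra, let N ∈ ℕ, and for each i = 1, …, N let (x_n^{(i)})_{n∈ℕ} be a central sequence in A. Then there exist a strictly increasing sequence (n(k))_{k∈ℕ} of natural numbers and elements y_k^{(i)} ∈ A (for i = 1, …, N and k ∈ ℕ) such that: (1) for each i, ‖y_k^{(i)} − x_{n(k)}^{(i)}‖ → 0 as k → ∞; and (2) whenever k ≠ k', the elements y_k^{(i)} and y_{k'}^{(i')} *-commute (i.e. y_k^{(i)} commutes with both y_{k'}^{(i')} and its adjoint (y_{k'}^{(i')})*), for all i, i' ∈ {1, …, N}. -/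
/-- A unital C*-algebra is locally matricial (LM) if every finite subset can be
approximated arbitrarily well from a unital C*-subalgebra *-isomorphic to a full matrix
algebra. -/
def IsLM (A : Type*) [CStarAlgebra A] : Prop :=
  ∀ (F : Finset A) (ε : ℝ), 0 < ε →
    ∃ M : StarSubalgebra ℂ A,
      (∃ m : ℕ, 0 < m ∧ Nonempty (M ≃⋆ₐ[ℂ] Matrix (Fin m) (Fin m) ℂ)) ∧
      ∀ a ∈ F, Metric.infDist a (M : Set A) < ε

open Filter Topology

section InvSqrt

variable {A : Type*} [CStarAlgebra A]

/-- The inverse square root of a selfadjoint element, by continuous functional calculus. -/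
noncomputable def invSqrt (h : A) : A := cfc (fun r : ℝ => (√r)⁻¹) h

lemma isSelfAdjoint_invSqrt (h : A) : IsSelfAdjoint (invSqrt h) := cfc_predicate _ h

lemma star_invSqrt (h : A) : star (invSqrt h) = invSqrt h := isSelfAdjoint_invSqrt h

lemma Commute.invSqrt_right {h b : A} (hb : Commute b h) : Commute b (invSqrt h) :=
  (hb.symm.cfc_real _).symm

lemma invSqrt_mem {h : A} {B : StarSubalgebra ℂ A} (hB : IsClosed (B : Set A)) (hh : h ∈ B) :
    invSqrt h ∈ B := by
  have : IsClosed (B : Set A) := hB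
  exact cfc_mem (𝕜' := ℂ) _ hh

lemma abs_sub_one_le_of_mem_spectrum {h : A} (hs : IsSelfAdjoint h) {r : ℝ}
    (hr : r ∈ spectrum ℝ h) : |r - 1| ≤ ‖h - 1‖ := by
  have key : cfc (fun r : ℝ => r - 1) h = h - 1 := by
    rw [cfc_sub (fun r : ℝ => r) (fun _ => 1) h, cfc_id' ℝ h, cfc_const_one ℝ h]
  exact (norm_cfc_le_iff (fun r : ℝ => r - 1) h (norm_nonneg (h - 1))).1
    (le_of_eq (by rw [key])) r hr

lemma continuousOn_inv_sqrt_spectrum {h : A} (hs : IsSelfAdjoint h) (h1 : ‖h - 1‖ ≤ 1 / 2) :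
    ContinuousOn (fun r : ℝ => (√r)⁻¹) (spectrum ℝ h) := by
  refine Real.continuous_sqrt.continuousOn.inv₀ fun r hr => ?_
  have := abs_le.1 (abs_sub_one_le_of_mem_spectrum hs hr)
  exact (Real.sqrt_pos.2 (by linarith)).ne'

lemma invSqrt_mul_invSqrt_mul {h : A} (hs : IsSelfAdjoint h) (h1 : ‖h - 1‖ ≤ 1 / 2) :
    invSqrt h * invSqrt h * h = 1 := by
  have hc := continuousOn_inv_sqrt_spectrum hs h1
  have key : cfc (fun r : ℝ => (√r)⁻¹ * (√r)⁻¹ * r) h = invSqrt h * invSqrt h * h := by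
    rw [cfc_mul (fun r : ℝ => (√r)⁻¹ * (√r)⁻¹) (fun r => r) h (hc.mul hc), cfc_mul _ _ h hc hc,
      cfc_id' ℝ h, invSqrt]
  rw [← key, ← cfc_const_one ℝ h]
  refine cfc_congr fun r hr => ?_
  have := abs_le.1 (abs_sub_one_le_of_mem_spectrum hs hr)
  have hr0 : 0 < r := by linarith
  simp only [← mul_inv, Real.mul_self_sqrt hr0.le]
  exact inv_mul_cancel₀ hr0.ne'

lemma norm_invSqrt_sub_one_le {h : A} (hs : IsSelfAdjoint h) (h1 : ‖h - 1‖ ≤ 1 / 2) :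
    ‖invSqrt h - 1‖ ≤ ‖h - 1‖ := by
  have hc := continuousOn_inv_sqrt_spectrum hs h1
  have key : cfc (fun r : ℝ => (√r)⁻¹ - 1) h = invSqrt h - 1 := by
    rw [cfc_sub _ (fun _ => 1) h hc, cfc_const_one ℝ h, invSqrt]
  rw [← key]
  refine norm_cfc_le (norm_nonneg _) fun r hr => ?_
  have hr1 := abs_sub_one_le_of_mem_spectrum hs hr
  refine le_trans ?_ hr1
  have hr2 := abs_le.1 (hr1.trans h1)
  have hpos : 0 < √r := Real.sqrt_pos.2 (by linarith)
  have hsq : √r * √r = r := Real.mul_self_sqrt (by linarith)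
  have hhalf : 1 / 2 ≤ √r := by nlinarith
  have e1 : (√r)⁻¹ - 1 = (1 - √r) / √r := by field_simp
  have e2 : |r - 1| = |1 - √r| * (1 + √r) := by
    rw [show r - 1 = -((1 - √r) * (1 + √r)) by linear_combination -hsq, abs_neg, abs_mul,
      abs_of_pos (show (0 : ℝ) < 1 + √r by linarith)]
  rw [Real.norm_eq_abs, e1, abs_div, abs_of_pos hpos, e2, div_le_iff₀ hpos, mul_assoc]
  exact le_mul_of_one_le_right (abs_nonneg _) (by nlinarith)

variable {ι : Type*} {l : Filter ι}

lemma eventually_norm_sub_one_le {h : ι → A} (h1 : Tendsto h l (𝓝 1)) :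
    ∀ᶠ n in l, ‖h n - 1‖ ≤ 1 / 2 :=
  (tendsto_iff_norm_sub_tendsto_zero.1 h1).eventually_le_const (by norm_num)

lemma Filter.Tendsto.invSqrt_one {h : ι → A} (hs : ∀ n, IsSelfAdjoint (h n))
    (h1 : Tendsto h l (𝓝 1)) : Tendsto (fun n => invSqrt (h n)) l (𝓝 1) := by
  rw [tendsto_iff_norm_sub_tendsto_zero]
  refine squeeze_zero' (.of_forall fun _ => norm_nonneg _) ?_
    (tendsto_iff_norm_sub_tendsto_zero.1 h1)
  filter_upwards [eventually_norm_sub_one_le h1] with n hn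
  exact norm_invSqrt_sub_one_le (hs n) hn

lemma eventually_invSqrt_mul_invSqrt_mul {h : ι → A} (hs : ∀ n, IsSelfAdjoint (h n))
    (h1 : Tendsto h l (𝓝 1)) : ∀ᶠ n in l, invSqrt (h n) * invSqrt (h n) * h n = 1 := by
  filter_upwards [eventually_norm_sub_one_le h1] with n hn
  exact invSqrt_mul_invSqrt_mul (hs n) hn

end InvSqrt

section Perturbation

variable {A : Type*} [CStarAlgebra A] {ι : Type*} {l : Filter ι} {B : ι → StarSubalgebra ℂ A}

/-- Elements converging to a projection can be replaced by projections. -/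
lemma exists_projections_tendsto (hB : ∀ n, IsClosed (B n : Set A)) {e : A}
    (hes : IsSelfAdjoint e) (hee : e * e = e) {q : ι → A} (hq : ∀ n, q n ∈ B n)
    (hqe : Tendsto q l (𝓝 e)) :
    ∃ p : ι → A, (∀ n, p n ∈ B n) ∧ (∀ n, IsSelfAdjoint (p n)) ∧ Tendsto p l (𝓝 e) ∧
      ∀ᶠ n in l, p n * p n = p n := by
  set s : ι → A := fun n => q n + star (q n) - 1 with hs_def
  have hsB : ∀ n, s n ∈ B n := fun n =>
    sub_mem (add_mem (hq n) (star_mem (hq n))) (one_mem _)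
  have hss : ∀ n, star (s n) = s n := fun n => by simp [hs_def, add_comm]
  have hslim : Tendsto s l (𝓝 (e + star e - 1)) := (hqe.add hqe.star).sub_const 1
  have hsq : ∀ n, IsSelfAdjoint (s n * s n) := fun n => by
    rw [isSelfAdjoint_iff, star_mul, hss]
  have hsqlim : Tendsto (fun n => s n * s n) l (𝓝 1) := by
    convert hslim.mul hslim using 2
    rw [hes.star_eq]
    simp only [mul_sub, mul_add, sub_mul, add_mul, hee, mul_one, one_mul]
    abel
  have hcomm : ∀ n, Commute (s n) (invSqrt (s n * s n)) := fun n =>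
    Commute.invSqrt_right ((Commute.refl _).mul_right (Commute.refl _))
  refine ⟨fun n => (1 / 2 : ℂ) • (1 + s n * invSqrt (s n * s n)), fun n => ?_, fun n => ?_, ?_, ?_⟩
  · exact (B n).smul_mem (add_mem (one_mem _)
      (mul_mem (hsB n) (invSqrt_mem (hB n) (mul_mem (hsB n) (hsB n))))) _
  · rw [isSelfAdjoint_iff, star_smul, star_add, star_mul, star_invSqrt, hss, ← (hcomm n).eq]
    simp
  · have := ((hslim.mul (hsqlim.invSqrt_one hsq)).const_add 1).const_smul (1 / 2 : ℂ)
    convert this using 2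
    rw [hes.star_eq, mul_one, add_sub_cancel, ← two_smul ℂ e, smul_smul]
    norm_num
  · filter_upwards [eventually_invSqrt_mul_invSqrt_mul hsq hsqlim] with n hn
    have h2 : s n * invSqrt (s n * s n) * (s n * invSqrt (s n * s n)) = 1 := by
      rw [(hcomm n).symm.mul_mul_mul_comm, ← hn]
      exact ((Commute.refl _).invSqrt_right.mul_right (Commute.refl _).invSqrt_right).eq
    rw [smul_mul_smul_comm, add_mul, mul_add, mul_add, h2, one_mul, mul_one, one_mul,
      show (1 : A) + s n * invSqrt (s n * s n) + (s n * invSqrt (s n * s n) + 1)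
        = (2 : ℂ) • (1 + s n * invSqrt (s n * s n)) by rw [two_smul]; abel, smul_smul]
    norm_num


variable {κ : Type*} [DecidableEq κ]

/-- The elements `e i` behave like the first column `e_{i1}` of a system of matrix units whose
diagonal is `p = e_{11}`; the products `e i * star (e j)` are the matrix units. -/
structure IsMatrixColumn [Fintype κ] (e : κ → A) (p : A) : Prop where
  star_mul_eq : ∀ i j, star (e i) * e j = if i = j then p else 0
  mul_right : ∀ i, e i * p = e i
  sum_mul_star : ∑ i, e i * star (e i) = 1

/-- Gram–Schmidt orthonormalization of approximate partial isometries with a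
common initial projection. -/
lemma exists_orthonormal_tendsto (hB : ∀ n, IsClosed (B n : Set A)) {e : κ → A} {q : A}
    (he : ∀ i j, star (e i) * e j = if i = j then q else 0) (heq : ∀ i, e i * q = e i)
    {c : κ → ι → A} (hc : ∀ i n, c i n ∈ B n) (hce : ∀ i, Tendsto (c i) l (𝓝 (e i)))
    {p : ι → A} (hp : ∀ n, p n ∈ B n) (hps : ∀ n, IsSelfAdjoint (p n))
    (hpq : Tendsto p l (𝓝 q)) (hpp : ∀ᶠ n in l, p n * p n = p n) (s : Finset κ) :
    ∃ f : κ → ι → A, (∀ i n, f i n ∈ B n) ∧ (∀ i, Tendsto (f i) l (𝓝 (e i))) ∧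
      ∀ᶠ n in l, ∀ i ∈ s, f i n * p n = f i n ∧
        ∀ j ∈ s, star (f i n) * f j n = if i = j then p n else 0 := by
  induction s using Finset.induction_on with
  | empty => exact ⟨c, hc, hce, by simp⟩
  | insert a s ha ih =>
    obtain ⟨f, hfB, hfe, hf⟩ := ih
    set g : ι → A := fun n => (1 - ∑ i ∈ s, f i n * star (f i n)) * f a n * p n with hg
    set h : ι → A := fun n => star (g n) * g n + 1 - p n with hh
    have hgB : ∀ n, g n ∈ B n := fun n => mul_mem (mul_mem (sub_mem (one_mem _)
      (sum_mem fun i _ => mul_mem (hfB i n) (star_mem (hfB i n)))) (hfB a n)) (hp n)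
    have hhB : ∀ n, h n ∈ B n := fun n =>
      sub_mem (add_mem (mul_mem (star_mem (hgB n)) (hgB n)) (one_mem _)) (hp n)
    have hglim : Tendsto g l (𝓝 (e a)) := by
      have := (((tendsto_finsetSum s fun i _ => (hfe i).mul (hfe i).star).const_sub 1).mul
        (hfe a)).mul hpq
      convert this using 2
      have h0 : ∀ i ∈ s, e i * star (e i) * e a = 0 := fun i hi => by
        rw [mul_assoc, he, if_neg (ne_of_mem_of_not_mem hi ha), mul_zero]
      rw [sub_mul, Finset.sum_mul, Finset.sum_eq_zero h0, sub_zero, one_mul, heq]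
    have hhs : ∀ n, IsSelfAdjoint (h n) := fun n =>
      ((IsSelfAdjoint.star_mul_self _).add (IsSelfAdjoint.one A)).sub (hps n)
    have hhlim : Tendsto h l (𝓝 1) := by
      have := ((hglim.star.mul hglim).add_const 1).sub hpq
      rwa [he, if_pos rfl, add_sub_cancel_left] at this
    refine ⟨Function.update f a fun n => g n * invSqrt (h n), fun i n => ?_, fun i => ?_, ?_⟩
    · by_cases hi : i = a
      · subst hi
        simpa using mul_mem (hgB n) (invSqrt_mem (hB n) (hhB n))
      · simpa [hi] using hfB i n
    · by_cases hi : i = a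
      · subst hi
        simpa using hglim.mul (hhlim.invSqrt_one hhs)
      · simpa [hi] using hfe i
    · filter_upwards [hf, hpp, eventually_invSqrt_mul_invSqrt_mul hhs hhlim] with n hfn hpn htn
      have hgp : g n * p n = g n := by simp only [hg, mul_assoc, hpn]
      have hpg : p n * star (g n) = star (g n) := by
        rw [← (hps n).star_eq, ← star_mul, hgp]
      have hhp : h n * p n = star (g n) * g n := by
        simp only [hh, sub_mul, add_mul, mul_assoc, hgp, hpn, one_mul, add_sub_cancel_right]
      have hph : p n * h n = star (g n) * g n := by
        simp only [hh, mul_sub, mul_add, ← mul_assoc, hpg, hpn, mul_one, add_sub_cancel_right]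
      have hpt : Commute (p n) (invSqrt (h n)) :=
        Commute.invSqrt_right (hph.trans hhp.symm)
      have hht : Commute (h n) (invSqrt (h n)) := (Commute.refl _).invSqrt_right
      have hold : ∀ j ∈ s, star (f j n) * g n = 0 := fun j hj => by
        have hpf : p n * star (f j n) = star (f j n) := by
          rw [← (hps n).star_eq, ← star_mul, (hfn j hj).1]
        have : star (f j n) * ∑ i ∈ s, f i n * star (f i n) = star (f j n) := by
          rw [Finset.mul_sum, Finset.sum_eq_single_of_mem j hj, ← mul_assoc, (hfn j hj).2 j hj,
            if_pos rfl, hpf]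
          intro i hi hij
          rw [← mul_assoc, (hfn j hj).2 i hi, if_neg hij.symm, zero_mul]
        simp only [hg]
        rw [← mul_assoc, ← mul_assoc, mul_sub, mul_one, this, sub_self, zero_mul, zero_mul]
      have hnew : star (g n * invSqrt (h n)) * (g n * invSqrt (h n)) = p n := by
        rw [star_mul, star_invSqrt, mul_assoc, ← mul_assoc (star (g n)), ← hph, mul_assoc,
          hht.eq, ← mul_assoc, ← mul_assoc, ← hpt.eq, mul_assoc, mul_assoc,
          ← mul_assoc (invSqrt _), htn, mul_one]
      have hne : ∀ i ∈ s, i ≠ a := fun i hi => ne_of_mem_of_not_mem hi ha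
      intro i hi
      rcases Finset.mem_insert.1 hi with rfl | his
      · refine ⟨by simp [mul_assoc, ← hpt.eq]; rw [← mul_assoc, hgp], fun j hj => ?_⟩
        rcases Finset.mem_insert.1 hj with rfl | hj
        · simpa using hnew
        · rw [Function.update_self, Function.update_of_ne (hne j hj), if_neg (hne j hj).symm,
            star_mul, mul_assoc, ← star_star (f j n), ← star_mul, hold j hj, star_zero, mul_zero]
      · rw [Function.update_of_ne (hne i his)]
        refine ⟨(hfn i his).1, fun j hj => ?_⟩
        rcases Finset.mem_insert.1 hj with rfl | hj
        · rw [Function.update_self, if_neg (hne i his), ← mul_assoc, hold i his, zero_mul]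
        · rw [Function.update_of_ne (hne j hj)]
          exact (hfn i his).2 j hj

lemma mem_unitary_of_isUnit {u : A} (hu : IsUnit u) (h : star u * u = 1) :
    u ∈ unitary A := by
  obtain ⟨v, rfl⟩ := hu
  refine Unitary.mem_iff.2 ⟨h, ?_⟩
  rw [← Units.inv_eq_of_mul_eq_one_left h, Units.mul_inv]

/-- If closed star subalgebras `B n` asymptotically contain a system of matrix units, then
unitaries converging to `1` conjugate it into them. -/
lemma IsMatrixColumn.exists_unitary_tendsto [Fintype κ] [Nonempty κ] (hB : ∀ n, IsClosed (B n : Set A))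
    {e : κ → A} {q : A} (he : IsMatrixColumn e q)
    {c : κ → ι → A} (hc : ∀ i n, c i n ∈ B n) (hce : ∀ i, Tendsto (c i) l (𝓝 (e i))) :
    ∃ u : ι → A, Tendsto u l (𝓝 1) ∧ ∀ᶠ n in l, u n ∈ unitary A ∧
      ∀ i j, star (u n) * (e i * star (e j)) * u n ∈ B n := by
  obtain ⟨i₀⟩ := ‹Nonempty κ›
  have hq : star (e i₀) * e i₀ = q := by rw [he.star_mul_eq, if_pos rfl]
  have hqs : IsSelfAdjoint q := hq ▸ IsSelfAdjoint.star_mul_self _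
  have hqq : q * q = q := by
    conv_lhs => rw [← hq, mul_assoc, hq, he.mul_right, hq]
  obtain ⟨p, hp, hps, hpq, hpp⟩ := exists_projections_tendsto hB hqs hqq
    (fun n => mul_mem (star_mem (hc i₀ n)) (hc i₀ n)) (hq ▸ (hce i₀).star.mul (hce i₀))
  obtain ⟨f, hfB, hfe, hf⟩ := exists_orthonormal_tendsto hB he.star_mul_eq he.mul_right hc hce
    hp hps hpq hpp Finset.univ
  set s : ι → A := fun n => ∑ i, e i * star (f i n) with hs
  have hslim : Tendsto s l (𝓝 1) := by
    rw [← he.sum_mul_star]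
    exact tendsto_finsetSum _ fun i _ => (hfe i).star.const_mul (e i)
  have hss : ∀ n, IsSelfAdjoint (star (s n) * s n) := fun n => .star_mul_self _
  have hsslim : Tendsto (fun n => star (s n) * s n) l (𝓝 1) := by
    simpa using hslim.star.mul hslim
  have hulim : Tendsto (fun n => s n * invSqrt (star (s n) * s n)) l (𝓝 1) := by
    simpa using hslim.mul (hsslim.invSqrt_one hss)
  refine ⟨_, hulim, ?_⟩
  filter_upwards [hf, eventually_invSqrt_mul_invSqrt_mul hss hsslim,
    hulim.eventually (Units.isOpen.mem_nhds isUnit_one)] with n hfn htn hun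
  set t := invSqrt (star (s n) * s n) with ht
  have htcomm : Commute (star (s n) * s n) t := (Commute.refl _).invSqrt_right
  have huu : star (s n * t) * (s n * t) = 1 := by
    rw [star_mul, ht, star_invSqrt, ← ht, mul_assoc, ← mul_assoc (star (s n)), htcomm.eq,
      ← mul_assoc, htn]
  refine ⟨mem_unitary_of_isUnit hun huu, fun i j => ?_⟩
  have hpf : ∀ k, p n * star (f k n) = star (f k n) := fun k => by
    rw [← (hps n).star_eq, ← star_mul, (hfn k (Finset.mem_univ k)).1]
  have hint : ∀ i j, e i * star (e j) * s n = s n * (f i n * star (f j n)) := fun i j => by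
    simp only [hs, Finset.mul_sum, Finset.sum_mul]
    rw [Finset.sum_eq_single j, Finset.sum_eq_single i]
    · rw [mul_assoc, ← mul_assoc (star (e j)), he.star_mul_eq, if_pos rfl, mul_assoc,
        ← mul_assoc (star (f i n)), (hfn i (Finset.mem_univ i)).2 i (Finset.mem_univ i),
        if_pos rfl, hpf, ← mul_assoc, he.mul_right]
    · intro k _ hk
      rw [mul_assoc, ← mul_assoc (star (f k n)),
        (hfn k (Finset.mem_univ k)).2 i (Finset.mem_univ i), if_neg hk, zero_mul, mul_zero]
    · simp
    · intro k _ hk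
      rw [mul_assoc, ← mul_assoc (star (e j)), he.star_mul_eq, if_neg hk.symm, zero_mul, mul_zero]
    · simp
  have hcomm : Commute (f i n * star (f j n)) (star (s n) * s n) := by
    have := congrArg star (hint j i)
    simp only [star_mul, star_star] at this
    rw [commute_iff_eq, ← mul_assoc, ← this, mul_assoc, hint, mul_assoc]
  have heq : star (s n * t) * (e i * star (e j)) * (s n * t) = f i n * star (f j n) := by
    rw [mul_assoc, ← mul_assoc (e i * _), hint, mul_assoc (s n), hcomm.invSqrt_right.eq,
      ← mul_assoc (s n), ← mul_assoc, huu, one_mul]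
  rw [heq]
  exact mul_mem (hfB i n) (star_mem (hfB j n))

end Perturbation

section Matricial

variable {A : Type*} [CStarAlgebra A]

/-- A star subalgebra is matricial if it is the image of a full matrix algebra of positive size. -/
def IsMatricial (M : StarSubalgebra ℂ A) : Prop :=
  ∃ (m : ℕ) (ψ : Matrix (Fin (m + 1)) (Fin (m + 1)) ℂ →⋆ₐ[ℂ] A), ψ.range = M

lemma IsLM.exists_isMatricial (hA : IsLM A) (F : Finset A) {ε : ℝ} (hε : 0 < ε) :
    ∃ M : StarSubalgebra ℂ A, IsMatricial M ∧ ∀ a ∈ F, ∃ b ∈ M, dist b a < ε := by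
  obtain ⟨M, ⟨m, hm, ⟨φ⟩⟩, hF⟩ := hA F ε hε
  obtain ⟨k, rfl⟩ := Nat.exists_eq_succ_of_ne_zero hm.ne'
  refine ⟨M, ⟨k, M.subtype.comp (φ.symm : Matrix _ _ ℂ →⋆ₐ[ℂ] M), ?_⟩, fun a ha => ?_⟩
  · ext x
    constructor
    · rintro ⟨y, rfl⟩
      exact (φ.symm y).2
    · intro hx
      exact ⟨φ ⟨x, hx⟩, by simp⟩
  · obtain ⟨b, hb, hab⟩ := (Metric.infDist_lt_iff ⟨0, zero_mem M⟩).1 (hF a ha)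
    exact ⟨b, hb, by rwa [dist_comm]⟩

lemma IsMatricial.isClosed {M : StarSubalgebra ℂ A} (hM : IsMatricial M) :
    IsClosed (M : Set A) := by
  obtain ⟨m, ψ, rfl⟩ := hM
  exact (LinearMap.range ψ.toAlgHom.toLinearMap).closed_of_finiteDimensional

lemma IsMatricial.map_conj {M : StarSubalgebra ℂ A} (hM : IsMatricial M) (u : unitary A) :
    IsMatricial (M.map (Unitary.conjStarAlgAut ℂ A u : A →⋆ₐ[ℂ] A)) := by
  obtain ⟨m, ψ, rfl⟩ := hM
  refine ⟨m, (Unitary.conjStarAlgAut ℂ A u : A →⋆ₐ[ℂ] A).comp ψ, ?_⟩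
  ext x
  constructor
  · rintro ⟨y, rfl⟩
    exact ⟨ψ y, ⟨y, rfl⟩, rfl⟩
  · rintro ⟨_, ⟨y, rfl⟩, rfl⟩
    exact ⟨y, rfl⟩

/-- A matricial star subalgebra is spanned by matrix units. -/
lemma IsMatricial.exists_isMatrixColumn {M : StarSubalgebra ℂ A} (hM : IsMatricial M) :
    ∃ (m : ℕ) (e : Fin (m + 1) → A) (q : A), IsMatrixColumn e q ∧ (∀ i, e i ∈ M) ∧
      ∀ a ∈ M, a ∈ Submodule.span ℂ (Set.range fun ij : Fin (m + 1) × Fin (m + 1) =>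
        e ij.1 * star (e ij.2)) := by
  obtain ⟨m, ψ, rfl⟩ := hM
  refine ⟨m, fun i => ψ (Matrix.single i 0 1), ψ (Matrix.single 0 0 1), ⟨?_, ?_, ?_⟩,
    fun i => ⟨_, rfl⟩, ?_⟩
  · intro i j
    rw [← map_star, ← map_mul, Matrix.star_eq_conjTranspose, Matrix.conjTranspose_single]
    split_ifs with h
    · subst h
      simp
    · simp [Matrix.single_mul_single_of_ne _ _ _ _ h]
  · intro i
    rw [← map_mul]
    simp
  · have : ∀ i : Fin (m + 1), ψ (Matrix.single i 0 1) * star (ψ (Matrix.single i 0 1))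
        = ψ (Matrix.single i i 1) := fun i => by
      rw [← map_star, ← map_mul, Matrix.star_eq_conjTranspose, Matrix.conjTranspose_single]
      simp
    simp only [this]
    rw [← map_sum, ← map_one ψ]
    congr 1
    ext i j
    simp only [Matrix.sum_apply, Matrix.single_apply, Matrix.one_apply, ite_and]
    simp
  · rintro _ ⟨x, rfl⟩
    have : ∀ i j : Fin (m + 1), ψ (Matrix.single i j (x i j))
        = x i j • (ψ (Matrix.single i 0 1) * star (ψ (Matrix.single j 0 1))) := fun i j => by
      rw [← map_star, ← map_mul, ← map_smul, Matrix.star_eq_conjTranspose,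
        Matrix.conjTranspose_single]
      simp
    change ψ x ∈ _
    rw [Matrix.matrix_eq_sum_single x, map_sum]
    refine sum_mem fun i _ => ?_
    rw [map_sum]
    refine sum_mem fun j _ => ?_
    rw [this]
    exact Submodule.smul_mem _ _ (Submodule.subset_span ⟨(i, j), rfl⟩)

/-- In an LM algebra, a matricial subalgebra can be enlarged to a matricial subalgebra
approximating a given finite set. -/
lemma IsLM.exists_isMatricial_ge (hA : IsLM A) {M : StarSubalgebra ℂ A} (hM : IsMatricial M)
    (F : Finset A) {ε : ℝ} (hε : 0 < ε) :
    ∃ M' : StarSubalgebra ℂ A, IsMatricial M' ∧ M ≤ M' ∧ ∀ a ∈ F, ∃ b ∈ M', dist b a < ε := by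
  classical
  obtain ⟨m, e, q, he, -, hspan⟩ := hM.exists_isMatrixColumn
  have hpos : ∀ n : ℕ, (0 : ℝ) < 1 / (n + 1) := fun n => Nat.one_div_pos_of_nat
  choose B hBmat hB using fun n : ℕ => hA.exists_isMatricial (F ∪ Finset.univ.image e) (hpos n)
  choose! c hcB hc using hB
  have hclim : ∀ a ∈ F ∪ Finset.univ.image e, Tendsto (fun n => c n a) atTop (𝓝 a) :=
    fun a ha => tendsto_iff_dist_tendsto_zero.2 <| squeeze_zero (fun _ => dist_nonneg)
      (fun n => (hc n a ha).le) tendsto_one_div_add_atTop_nhds_zero_nat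
  have hmem : ∀ i, e i ∈ F ∪ Finset.univ.image e := fun i => by simp
  obtain ⟨u, hu1, hu⟩ := he.exists_unitary_tendsto (fun n => (hBmat n).isClosed)
    (c := fun i n => c n (e i)) (fun i n => hcB n _ (hmem i)) (fun i => hclim _ (hmem i))
  have hclose : ∀ᶠ n in atTop, ∀ a ∈ F, dist (u n * c n a * star (u n)) a < ε := by
    rw [Filter.eventually_all_finset]
    intro a ha
    have := (hu1.mul (hclim a (Finset.mem_union_left _ ha))).mul hu1.star
    rw [one_mul, star_one, mul_one] at this
    exact (tendsto_iff_dist_tendsto_zero.1 this).eventually_lt_const hε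
  obtain ⟨n, ⟨hun, hue⟩, hn⟩ := (hu.and hclose).exists
  set M' := (B n).map (Unitary.conjStarAlgAut ℂ A ⟨u n, hun⟩ : A →⋆ₐ[ℂ] A)
  refine ⟨M', (hBmat n).map_conj ⟨u n, hun⟩, fun a ha => ?_, fun a ha => ?_⟩
  · refine (Submodule.span_le (p := Subalgebra.toSubmodule M'.toSubalgebra)).2 ?_ (hspan a ha)
    rintro _ ⟨ij, rfl⟩
    refine ⟨_, hue ij.1 ij.2, ?_⟩
    change u n * (star (u n) * (e ij.1 * star (e ij.2)) * u n) * star (u n) = _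
    have huu : u n * star (u n) = 1 := Unitary.mul_star_self_of_mem hun
    rw [mul_assoc (star (u n)), ← mul_assoc, ← mul_assoc, huu, one_mul, mul_assoc, huu, mul_one]
  · exact ⟨_, ⟨c n a, hcB n a (Finset.mem_union_left _ ha), rfl⟩, hn a ha⟩

/-- The compression onto the commutant of a matricial subalgebra. -/
lemma IsMatricial.exists_map_commutant {M : StarSubalgebra ℂ A} (hM : IsMatricial M) :
    ∃ E : A → A, Continuous E ∧ (∀ x, ∀ a ∈ M, Commute (E x) a) ∧
      (∀ M' : StarSubalgebra ℂ A, M ≤ M' → ∀ x ∈ M', E x ∈ M') ∧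
      ∀ x : ℕ → A, IsCentralSequence x → Tendsto (fun n => ‖E (x n) - x n‖) atTop (𝓝 0) := by
  obtain ⟨m, e, q, he, heM, hspan⟩ := hM.exists_isMatrixColumn
  refine ⟨fun x => ∑ i, e i * x * star (e i), by fun_prop, fun x a ha => ?_,
    fun M' hM' x hx => sum_mem fun i _ =>
      mul_mem (mul_mem (hM' (heM i)) hx) (star_mem (hM' (heM i))), fun x hx => ?_⟩
  · refine Submodule.span_induction ?_ (Commute.zero_right _) (fun _ _ _ _ => .add_right)
      (fun c _ _ h => h.smul_right c) (hspan a ha)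
    rintro _ ⟨⟨k, j⟩, rfl⟩
    have hq : ∀ k, q * star (e k) = star (e k) := fun k => by
      have : q = star (e k) * e k := by rw [he.star_mul_eq, if_pos rfl]
      have hqs : star q = q := by rw [this, star_mul, star_star]
      rw [← hqs, ← star_mul, he.mul_right]
    rw [commute_iff_eq, Finset.sum_mul, Finset.mul_sum, Finset.sum_eq_single k,
      Finset.sum_eq_single j]
    · have h1 : e k * x * star (e k) * (e k * star (e j))
          = e k * x * ((star (e k) * e k) * star (e j)) := by simp only [mul_assoc]
      have h2 : e k * star (e j) * (e j * x * star (e j))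
          = e k * (star (e j) * e j) * x * star (e j) := by simp only [mul_assoc]
      rw [h1, h2, he.star_mul_eq, he.star_mul_eq, if_pos rfl, if_pos rfl, hq, he.mul_right]
    · intro i _ hi
      have h2 : e k * star (e j) * (e i * x * star (e i))
          = e k * (star (e j) * e i) * x * star (e i) := by simp only [mul_assoc]
      rw [h2, he.star_mul_eq, if_neg hi.symm, mul_zero, zero_mul, zero_mul]
    · simp
    · intro i _ hi
      have h1 : e i * x * star (e i) * (e k * star (e j))
          = e i * x * ((star (e i) * e k) * star (e j)) := by simp only [mul_assoc]
      rw [h1, he.star_mul_eq, if_neg hi, zero_mul, mul_zero]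
    · simp
  · have key : ∀ n, ∑ i, e i * x n * star (e i) - x n
        = ∑ i, e i * (x n * star (e i) - star (e i) * x n) := fun n => by
      simp only [mul_sub, Finset.sum_sub_distrib, ← mul_assoc]
      rw [← Finset.sum_mul, he.sum_mul_star, one_mul]
    simp only [key]
    have hlim : Tendsto (fun n => ∑ i, e i * (x n * star (e i) - star (e i) * x n)) atTop
        (𝓝 (∑ i, e i * 0)) := tendsto_finsetSum _ fun i _ =>
      (tendsto_zero_iff_norm_tendsto_zero.2 (hx.2 (star (e i)))).const_mul (e i)
    simpa using hlim.norm

/-- The inductive step: far out in finitely many central sequences there are terms close to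
elements of a larger matricial subalgebra which commute with the given one. -/
lemma IsLM.exists_commuting_approximation (hA : IsLM A) {N : ℕ} {x : Fin N → ℕ → A}
    (hx : ∀ i, IsCentralSequence (x i)) {M : StarSubalgebra ℂ A} (hM : IsMatricial M) (n₀ : ℕ)
    {ε : ℝ} (hε : 0 < ε) :
    ∃ (n : ℕ) (M' : StarSubalgebra ℂ A) (y : Fin N → A), n₀ < n ∧ IsMatricial M' ∧ M ≤ M' ∧
      (∀ i, y i ∈ M') ∧ (∀ i, ∀ a ∈ M, Commute (y i) a) ∧ ∀ i, ‖y i - x i n‖ < ε := by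
  classical
  obtain ⟨E, hEc, hEM, hEM', hEx⟩ := hM.exists_map_commutant
  have h1 : ∀ᶠ n in atTop, ∀ i, ‖E (x i n) - x i n‖ < ε / 2 :=
    Filter.eventually_all.2 fun i => (hEx _ (hx i)).eventually_lt_const (half_pos hε)
  obtain ⟨n, hn, hnn⟩ := (h1.and (eventually_gt_atTop n₀)).exists
  have h2 : ∀ i, ∃ δ > 0, ∀ b, dist b (x i n) < δ → dist (E b) (E (x i n)) < ε / 2 := fun i => by
    simpa using Metric.continuous_iff.1 hEc (x i n) (ε / 2) (half_pos hε)
  choose δ hδ hEδ using h2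
  obtain ⟨η, hη, hηδ⟩ : ∃ η > 0, ∀ i, η ≤ δ i := by
    have : ∀ᶠ η in 𝓝[>] (0 : ℝ), ∀ i, η ≤ δ i := Filter.eventually_all.2 fun i =>
      (eventually_le_nhds (hδ i)).filter_mono nhdsWithin_le_nhds
    exact (eventually_mem_nhdsWithin.and this).exists
  obtain ⟨M', hM', hle, hb⟩ :=
    hA.exists_isMatricial_ge hM (Finset.univ.image fun i => x i n) hη
  choose b hbM hbx using fun i => hb (x i n) (by simp)
  refine ⟨n, M', fun i => E (b i), hnn, hM', hle, fun i => hEM' M' hle _ (hbM i),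
    fun i => hEM (b i), fun i => ?_⟩
  have h3 := hEδ i (b i) ((hbx i).trans_le (hηδ i))
  rw [dist_eq_norm] at h3
  calc ‖E (b i) - x i n‖ ≤ ‖E (b i) - E (x i n)‖ + ‖E (x i n) - x i n‖ :=
        norm_sub_le_norm_sub_add_norm_sub ..
    _ < ε := by linarith [hn i]

end Matricial

/-- Given finitely many central sequences `x i` in a unital LM algebra,
there are a strictly increasing sequence `n` and elements `y i k` such that
`‖y i k − x i (n k)‖ → 0` for each `i`, and for `k ≠ k'` the elements `y i k` and
`y i' k'` *-commute. -/
theorem stmt_12 {A : Type*} [CStarAlgebra A] (hA : IsLM A)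
    (N : ℕ) (x : Fin N → ℕ → A) (hx : ∀ i, IsCentralSequence (x i)) :
    ∃ n : ℕ → ℕ, StrictMono n ∧ ∃ y : Fin N → ℕ → A,
      (∀ i, Filter.Tendsto (fun k => ‖y i k - x i (n k)‖) Filter.atTop (nhds 0)) ∧
      (∀ i i' : Fin N, ∀ k k' : ℕ, k ≠ k' →
        Commute (y i k) (y i' k') ∧ Commute (y i k) (star (y i' k'))) := by
  obtain ⟨M₀, hM₀, -⟩ := hA.exists_isMatricial ∅ one_pos
  have hpos : ∀ k : ℕ, (0 : ℝ) < 1 / (k + 1) := fun k => Nat.one_div_pos_of_nat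
  choose! nxt Mxt yxt hnxt hmat hle hymem hycomm hyx using
    fun (M : StarSubalgebra ℂ A) (hM : IsMatricial M) (n₀ k : ℕ) =>
      hA.exists_commuting_approximation hx hM n₀ (hpos k)
  let S : ℕ → StarSubalgebra ℂ A × ℕ := fun k => Nat.rec (M₀, 0)
    (fun k s => (Mxt s.1 s.2 k, nxt s.1 s.2 k)) k
  have hS : ∀ k, IsMatricial (S k).1 := fun k => by
    induction k with
    | zero => exact hM₀
    | succ k ih => exact hmat _ ih _ _
  have hmono : Monotone fun k => (S k).1 := monotone_nat_of_le_succ fun k => hle _ (hS k) _ _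
  let y : Fin N → ℕ → A := fun i k => yxt (S k).1 (S k).2 k i
  have hyS : ∀ i {k k'}, k < k' → y i k ∈ (S k').1 := fun i k k' hk =>
    hmono (Nat.succ_le_of_lt hk) (hymem _ (hS k) _ _ i)
  have hyc : ∀ i k, ∀ a ∈ (S k).1, Commute (y i k) a := fun i k => hycomm _ (hS k) _ _ i
  refine ⟨fun k => (S (k + 1)).2, strictMono_nat_of_lt_succ fun k => hnxt _ (hS (k + 1)) _ _, y,
    fun i => squeeze_zero (fun _ => norm_nonneg _) (fun k => (hyx _ (hS k) _ k i).le)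
      tendsto_one_div_add_atTop_nhds_zero_nat, fun i i' k k' hkk' => ?_⟩
  rcases hkk'.lt_or_gt with hk | hk
  · refine ⟨(hyc i' k' _ (hyS i hk)).symm, ?_⟩
    simpa using (hyc i' k' _ (star_mem (hyS i hk))).symm.star_star
  · exact ⟨hyc i k _ (hyS i' hk), hyc i k _ (star_mem (hyS i' hk))⟩
end

section
/- Let A be a separable unital locally matricial (LM) C*-algebra. Then every hypercentral sequence in A is trivial; that is, for every hypercentral sequence (x_n)_{n∈ℕ} in A there exists a sequence (z_n)_{n∈ℕ} of elements of the center Z(A) of A such that ‖x_n − z_n‖ → 0. -/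
/-- A central sequence is hypercentral if it asymptotically commutes with every central
sequence. -/
def IsHypercentral {A : Type*} [CStarAlgebra A] (x : ℕ → A) : Prop :=
  IsCentralSequence x ∧ ∀ y : ℕ → A, IsCentralSequence y →
    Filter.Tendsto (fun n => ‖x n * y n - y n * x n‖) Filter.atTop (nhds 0)

open Filter Topology

namespace IsLM

section MatrixUnits

variable {A : Type*} [CStarAlgebra A] {m : ℕ}

/-- The image in `A` of the matrix unit `e i j` under a representation of a matrix algebra. -/
noncomputable def unitOf (φ : Matrix (Fin m) (Fin m) ℂ →⋆ₐ[ℂ] A) (i j : Fin m) : A :=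
  φ (Matrix.single i j 1)

variable (φ : Matrix (Fin m) (Fin m) ℂ →⋆ₐ[ℂ] A)

lemma unitOf_mul_unitOf (i j k l : Fin m) :
    unitOf φ i j * unitOf φ k l = if j = k then unitOf φ i l else 0 := by
  split_ifs with h
  · subst h
    simp [unitOf, ← map_mul]
  · simp [unitOf, ← map_mul, h]

lemma unitOf_mul_unitOf_same (i j l : Fin m) :
    unitOf φ i j * unitOf φ j l = unitOf φ i l := by
  simp [unitOf_mul_unitOf]

lemma star_unitOf (i j : Fin m) : star (unitOf φ i j) = unitOf φ j i := by
  simp [unitOf, ← map_star, Matrix.star_eq_conjTranspose]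

lemma sum_unitOf_self : ∑ i, unitOf φ i i = 1 := by
  have h : ∑ i : Fin m, Matrix.single i i (1 : ℂ) = 1 := by
    simp [Matrix.sum_single_eq_diagonal]
  simp only [unitOf]
  rw [← map_sum, h, map_one]

lemma commute_of_forall_unitOf {y : A} (h : ∀ i j, Commute (unitOf φ i j) y)
    (b : Matrix (Fin m) (Fin m) ℂ) : Commute (φ b) y := by
  have hb : b = ∑ i, ∑ j, b i j • Matrix.single i j (1 : ℂ) := by
    conv_lhs => rw [Matrix.matrix_eq_sum_single b]
    simp [Matrix.smul_single]
  rw [hb]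
  simp only [map_sum, map_smul]
  exact Commute.sum_left _ _ _ fun i _ => Commute.sum_left _ _ _ fun j _ =>
    (h i j).smul_left _

/-- The `(i, j)` coefficient of `a` with respect to the matrix units; it lies in the relative
commutant of the range of `φ`. -/
noncomputable def coeff (i j : Fin m) (a : A) : A :=
  ∑ k, unitOf φ k i * a * unitOf φ j k

lemma commute_coeff (i j : Fin m) (a : A) (b : Matrix (Fin m) (Fin m) ℂ) :
    Commute (φ b) (coeff φ i j a) := by
  refine commute_of_forall_unitOf φ (fun k l => ?_) b
  simp only [Commute, SemiconjBy, coeff, Finset.mul_sum, Finset.sum_mul]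
  rw [Finset.sum_eq_single l, Finset.sum_eq_single k]
  · simp only [← mul_assoc, unitOf_mul_unitOf_same]
    simp only [mul_assoc, unitOf_mul_unitOf_same]
  · intro r _ hr
    simp [mul_assoc, unitOf_mul_unitOf, hr]
  · simp
  · intro r _ hr
    simp [← mul_assoc, unitOf_mul_unitOf, hr.symm]
  · simp

lemma exists_coeff_ne_zero {a : A} (ha : a ≠ 0) : ∃ i j, coeff φ i j a ≠ 0 := by
  by_contra! h
  have key : ∀ i j, unitOf φ i i * a * unitOf φ j j = 0 := by
    intro i j
    have h1 : unitOf φ i i * coeff φ i j a * unitOf φ i j = 0 := by simp [h]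
    rw [coeff, Finset.mul_sum, Finset.sum_mul, Finset.sum_eq_single i] at h1
    · simpa only [← mul_assoc, unitOf_mul_unitOf_same] using
        (by simpa only [mul_assoc, unitOf_mul_unitOf_same] using h1 :
          unitOf φ i i * (unitOf φ i i * (a * unitOf φ j j)) = 0)
    · intro r _ hr
      simp [← mul_assoc, unitOf_mul_unitOf, hr.symm]
    · simp
  apply ha
  calc a = (∑ i, unitOf φ i i) * a * ∑ j, unitOf φ j j := by simp [sum_unitOf_self]
    _ = 0 := by simp [Finset.sum_mul, Finset.mul_sum, key]

lemma coeff_mul_mul {f g : A} (hf : ∀ b, Commute (φ b) f) (hg : ∀ b, Commute (φ b) g)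
    (i j : Fin m) (a : A) : coeff φ i j (f * a * g) = f * coeff φ i j a * g := by
  simp only [coeff, Finset.mul_sum, Finset.sum_mul]
  refine Finset.sum_congr rfl fun k _ => ?_
  have h1 : unitOf φ k i * f = f * unitOf φ k i := hf _
  have h2 : unitOf φ j k * g = g * unitOf φ j k := hg _
  calc unitOf φ k i * (f * a * g) * unitOf φ j k
      = (unitOf φ k i * f) * a * (g * unitOf φ j k) := by simp only [mul_assoc]
    _ = _ := by rw [h1, ← h2]; simp only [mul_assoc]

/-- The conditional expectation onto the relative commutant of the range of `φ`. -/
noncomputable def expect (a : A) : A := (m : ℝ)⁻¹ • ∑ i, coeff φ i i a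

lemma commute_expect (a : A) (b : Matrix (Fin m) (Fin m) ℂ) : Commute (φ b) (expect φ a) :=
  (Commute.sum_right _ _ _ fun i _ => commute_coeff φ i i a b).smul_right _

lemma isSelfAdjoint_expect {a : A} (ha : IsSelfAdjoint a) : IsSelfAdjoint (expect φ a) := by
  have h : IsSelfAdjoint (∑ i, coeff φ i i a) := by
    rw [IsSelfAdjoint]
    simp [coeff, star_sum, star_unitOf, ha.star_eq, mul_assoc]
  exact (IsSelfAdjoint.all (m : ℝ)⁻¹).smul h

lemma expect_sub (hm : 0 < m) (a : A) :
    expect φ a - a =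
      (m : ℝ)⁻¹ • ∑ i, ∑ k, unitOf φ k i * (a * unitOf φ i k - unitOf φ i k * a) := by
  have h : ∑ i, ∑ k, unitOf φ k i * (unitOf φ i k * a) = (m : ℝ) • a := by
    simp only [← mul_assoc, unitOf_mul_unitOf_same, ← Finset.sum_mul, sum_unitOf_self, one_mul]
    simp [Nat.cast_smul_eq_nsmul]
  have hm' : (m : ℝ) ≠ 0 := by positivity
  simp only [mul_sub, Finset.sum_sub_distrib, h, smul_sub, smul_smul, inv_mul_cancel₀ hm',
    one_smul, expect, coeff, mul_assoc]

lemma tendsto_expect_sub (hm : 0 < m) {x : ℕ → A} (hx : IsCentralSequence x) :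
    Tendsto (fun n => ‖expect φ (x n) - x n‖) atTop (𝓝 0) := by
  rw [← tendsto_zero_iff_norm_tendsto_zero]
  simp only [expect_sub φ hm]
  have h : ∀ i k, Tendsto (fun n => unitOf φ k i * (x n * unitOf φ i k - unitOf φ i k * x n))
      atTop (𝓝 0) := fun i k => by
    simpa using (tendsto_zero_iff_norm_tendsto_zero.2 (hx.2 (unitOf φ i k))).const_mul
      (unitOf φ k i)
  simpa using (tendsto_finsetSum Finset.univ fun i _ =>
    tendsto_finsetSum Finset.univ fun k _ => h i k).const_smul ((m : ℝ)⁻¹)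

end MatrixUnits

lemma _root_.ContinuousLinearMap.exists_norm_le_one_lt_norm_mul_mul {E : Type*}
    [NormedAddCommGroup E] [InnerProductSpace ℂ E] [CompleteSpace E] (a b : E →L[ℂ] E) {r s : ℝ}
    (hr0 : 0 ≤ r) (hs0 : 0 ≤ s) (hr : r < ‖a‖) (hs : s < ‖b‖) :
    ∃ u : E →L[ℂ] E, ‖u‖ ≤ 1 ∧ r * s < ‖a * u * b‖ := by
  obtain ⟨w, hw, haw⟩ := a.exists_lt_apply_of_lt_opNorm hr
  have hs' : s < ‖ContinuousLinearMap.adjoint b‖ := by simpa using hs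
  obtain ⟨v, hv, hbv⟩ := (ContinuousLinearMap.adjoint b).exists_lt_apply_of_lt_opNorm hs'
  refine ⟨InnerProductSpace.rankOne ℂ w v, ?_, ?_⟩
  · rw [InnerProductSpace.norm_rankOne]
    exact mul_le_one₀ hw.le (norm_nonneg _) hv.le
  · rw [ContinuousLinearMap.mul_def, ContinuousLinearMap.mul_def,
      InnerProductSpace.comp_rankOne, InnerProductSpace.rankOne_comp,
      InnerProductSpace.norm_rankOne]
    exact mul_lt_mul'' haw hbv hr0 hs0

variable {A : Type*} [CStarAlgebra A]

lemma exists_starAlgHom (hA : IsLM A) (F : Finset A) {ε : ℝ} (hε : 0 < ε) :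
    ∃ m : ℕ, 0 < m ∧ ∃ φ : Matrix (Fin m) (Fin m) ℂ →⋆ₐ[ℂ] A, Function.Injective φ ∧
      ∀ a ∈ F, ∃ b, ‖a - φ b‖ < ε := by
  obtain ⟨M, ⟨m, hm, ⟨e⟩⟩, hM⟩ := hA F ε hε
  refine ⟨m, hm, M.subtype.comp (e.symm : Matrix (Fin m) (Fin m) ℂ →⋆ₐ[ℂ] M), ?_, fun a ha => ?_⟩
  · exact Subtype.val_injective.comp e.symm.injective
  · obtain ⟨y, hy, hay⟩ := (Metric.infDist_lt_iff ⟨1, one_mem M⟩).1 (hM a ha)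
    refine ⟨e ⟨y, hy⟩, ?_⟩
    simpa [dist_eq_norm] using hay

/-- A locally matricial algebra is prime. -/
lemma exists_mul_mul_ne_zero (hA : IsLM A) {f g : A} (hf : f ≠ 0) (hg : g ≠ 0) :
    ∃ a, f * a * g ≠ 0 := by
  classical
  by_contra! h
  have hF : 0 < ‖f‖ := norm_pos_iff.2 hf
  have hG : 0 < ‖g‖ := norm_pos_iff.2 hg
  obtain ⟨ε, hε, hεf, hεg, hεfg⟩ : ∃ ε : ℝ, 0 < ε ∧ 2 * ε < ‖f‖ ∧ 2 * ε < ‖g‖ ∧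
      4 * (ε * (‖f‖ + ‖g‖)) < ‖f‖ * ‖g‖ := by
    have h0 : ∀ c : ℝ, Tendsto (fun ε : ℝ => ε * c) (𝓝[>] 0) (𝓝 0) := fun c => by
      simpa using (tendsto_nhdsWithin_of_tendsto_nhds (tendsto_id (x := 𝓝 (0 : ℝ)))).mul_const c
    have h1 := (h0 2).eventually (gt_mem_nhds hF)
    have h2 := (h0 2).eventually (gt_mem_nhds hG)
    have h3 := (h0 (4 * (‖f‖ + ‖g‖))).eventually (gt_mem_nhds (mul_pos hF hG))
    obtain ⟨ε, h1, h2, h3, h4⟩ := (h1.and (h2.and (h3.and self_mem_nhdsWithin))).exists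
    exact ⟨ε, h4, by linarith, by linarith, by linarith⟩
  obtain ⟨m, -, φ, hφ, hF'⟩ := exists_starAlgHom hA {f, g} hε
  obtain ⟨b, hb⟩ := hF' f (by simp)
  obtain ⟨c, hc⟩ := hF' g (by simp)
  let T := Matrix.toEuclideanCLM (n := Fin m) (𝕜 := ℂ)
  let ψ : (EuclideanSpace ℂ (Fin m) →L[ℂ] EuclideanSpace ℂ (Fin m)) →⋆ₐ[ℂ] A :=
    φ.comp (T.symm : _ →⋆ₐ[ℂ] Matrix (Fin m) (Fin m) ℂ)
  have hψ : Function.Injective ψ := hφ.comp T.symm.injective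
  have hnorm : ∀ y, ‖ψ y‖ = ‖y‖ := NonUnitalStarAlgHom.norm_map ψ hψ
  have hψT : ∀ y, ψ (T y) = φ y := fun y => by simp [ψ]
  have hTb : ‖T b‖ = ‖φ b‖ := by rw [← hnorm, hψT]
  have hTc : ‖T c‖ = ‖φ c‖ := by rw [← hnorm, hψT]
  have hb1 : ‖f‖ - ε < ‖T b‖ := by
    rw [hTb]; linarith [norm_sub_norm_le f (φ b)]
  have hc1 : ‖g‖ - ε < ‖T c‖ := by
    rw [hTc]; linarith [norm_sub_norm_le g (φ c)]
  have hc2 : ‖φ c‖ ≤ ‖g‖ + ε := by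
    linarith [norm_sub_norm_le (φ c) g, norm_sub_rev g (φ c)]
  obtain ⟨u, hu, hbuc⟩ := ContinuousLinearMap.exists_norm_le_one_lt_norm_mul_mul (T b) (T c)
    (by linarith) (by linarith) hb1 hc1
  rw [← hnorm u] at hu
  rw [← hnorm, map_mul, map_mul, hψT, hψT] at hbuc
  have heq : φ b * ψ u * φ c = -((f - φ b) * ψ u * φ c) - f * ψ u * (g - φ c) := by
    have := h (ψ u)
    simp only [mul_sub, sub_mul, this]
    abel
  have hle : ‖φ b * ψ u * φ c‖ ≤ ε * 1 * (‖g‖ + ε) + ‖f‖ * 1 * ε := by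
    rw [heq]
    refine (norm_sub_le _ _).trans (add_le_add ?_ ?_)
    · rw [norm_neg]
      refine (norm_mul₃_le).trans ?_
      gcongr
    · refine (norm_mul₃_le).trans ?_
      gcongr
  nlinarith

/-- Spectral localization: a nonzero element on which `x` acts, up to `ε`, as the scalar `α`. -/
lemma exists_spectral_localization {x : A} (hx : IsSelfAdjoint x) {α : ℝ}
    (hα : α ∈ spectrum ℝ x) {ε : ℝ} (hε : 0 < ε) :
    ∃ f c : A, f ≠ 0 ∧ ‖c‖ ≤ ε ∧ (x - algebraMap ℝ A α) * f = c * f ∧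
      f * (x - algebraMap ℝ A α) = f * c ∧ ∀ b, Commute x b → Commute f b := by
  let p : ℝ → ℝ := fun t => max 0 (ε - |t - α|)
  let q : ℝ → ℝ := fun t => max (-ε) (min ε (t - α))
  have hp : Continuous p := by fun_prop
  have hq : Continuous q := by fun_prop
  have hpq : ∀ t, (t - α) * p t = q t * p t := by
    intro t
    by_cases ht : |t - α| ≤ ε
    · have := abs_le.1 ht
      simp only [q, min_eq_right this.2, max_eq_right this.1]
    · have : p t = 0 := max_eq_left (by linarith)
      simp [this]
  have hsub : x - algebraMap ℝ A α = cfc (fun t : ℝ => t - α) x := by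
    rw [cfc_sub (fun t : ℝ => t) (fun _ => α) x, cfc_id' ℝ x, cfc_const α x]
  have hcomm : ∀ r s : ℝ → ℝ, cfc r x * cfc s x = cfc s x * cfc r x := fun r s =>
    cfc_commute_cfc r s x
  have hmul : (x - algebraMap ℝ A α) * cfc p x = cfc q x * cfc p x := by
    rw [hsub, ← cfc_mul (fun t : ℝ => t - α) p x, ← cfc_mul q p x]
    simp only [hpq]
  refine ⟨cfc p x, cfc q x, ?_, ?_, hmul, ?_, fun b hb => hb.cfc_real p⟩
  · intro h0
    have h1 := norm_apply_le_norm_cfc p x hα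
    rw [h0, norm_zero] at h1
    have : p α = ε := by simp [p, hε.le]
    rw [this, Real.norm_eq_abs] at h1
    linarith [le_abs_self ε]
  · refine norm_cfc_le hε.le fun t _ => ?_
    rw [Real.norm_eq_abs, abs_le]
    exact ⟨le_max_left _ _, max_le (by linarith) (min_le_left _ _)⟩
  · rw [hcomm p q, ← hmul, hsub, hcomm]

lemma exists_norm_sub_algebraMap_le [Nontrivial A] {x : A} (hx : IsSelfAdjoint x) :
    ∃ α ∈ spectrum ℝ x, ∃ β ∈ spectrum ℝ x, ‖x - algebraMap ℝ A α‖ = |α - β| := by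
  obtain ⟨α, hα⟩ := ContinuousFunctionalCalculus.spectrum_nonempty (R := ℝ) x hx
  have hsub : x - algebraMap ℝ A α = cfc (fun t : ℝ => t - α) x := by
    rw [cfc_sub (fun t : ℝ => t) (fun _ => α) x, cfc_id' ℝ x, cfc_const α x]
  obtain ⟨β, hβ, h⟩ := (IsGreatest.norm_cfc (𝕜 := ℝ) (fun t : ℝ => t - α) x).1
  refine ⟨α, hα, β, hβ, ?_⟩
  rw [hsub, ← h, abs_sub_comm]
  rfl

/-- In the relative commutant of a matrix subalgebra, a selfadjoint element is nearly as far from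
commuting with some contraction as it is from the scalars. -/
lemma exists_commutant_norm_commutator_ge (hA : IsLM A) [Nontrivial A] {m : ℕ}
    (φ : Matrix (Fin m) (Fin m) ℂ →⋆ₐ[ℂ] A) {x : A} (hx : IsSelfAdjoint x)
    (hxφ : ∀ b, Commute (φ b) x) {ε : ℝ} (hε : 0 < ε) :
    ∃ (α : ℝ) (y : A), ‖y‖ ≤ 1 ∧ (∀ b, Commute (φ b) y) ∧
      ‖x - algebraMap ℝ A α‖ ≤ ‖x * y - y * x‖ + 2 * ε := by
  obtain ⟨α, hα, β, hβ, hαβ⟩ := exists_norm_sub_algebraMap_le hx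
  obtain ⟨f, c, hf, hc, hfc, -, hfcomm⟩ := exists_spectral_localization hx hα hε
  obtain ⟨g, d, hg, hd, -, hgd, hgcomm⟩ := exists_spectral_localization hx hβ hε
  have hfφ : ∀ b, Commute (φ b) f := fun b => (hfcomm _ (hxφ b).symm).symm
  have hgφ : ∀ b, Commute (φ b) g := fun b => (hgcomm _ (hxφ b).symm).symm
  obtain ⟨a, ha⟩ := exists_mul_mul_ne_zero hA hf hg
  obtain ⟨i, j, hij⟩ := exists_coeff_ne_zero φ ha
  rw [coeff_mul_mul φ hfφ hgφ] at hij
  set w := f * coeff φ i j a * g with hw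
  have hwpos : 0 < ‖w‖ := norm_pos_iff.2 hij
  have hwφ : ∀ b, Commute (φ b) w := fun b =>
    ((hfφ b).mul_right (commute_coeff φ i j a b)).mul_right (hgφ b)
  have hleft : (x - algebraMap ℝ A α) * w = c * w := by
    rw [hw]; simp only [← mul_assoc, hfc]
  have hright : w * (x - algebraMap ℝ A β) = w * d := by
    rw [hw]; simp only [mul_assoc, hgd]
  have hkey : (α - β) • w = (x * w - w * x) - c * w + w * d := by
    rw [← hleft, ← hright]
    simp only [sub_mul, mul_sub, Algebra.algebraMap_eq_smul_one, smul_mul_assoc, mul_smul_comm,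
      one_mul, mul_one, sub_smul]
    abel
  have hbound : |α - β| * ‖w‖ ≤ ‖x * w - w * x‖ + 2 * ε * ‖w‖ := by
    rw [← Real.norm_eq_abs, ← norm_smul, hkey]
    have h1 : ‖c * w‖ ≤ ε * ‖w‖ := (norm_mul_le _ _).trans (by gcongr)
    have h2 : ‖w * d‖ ≤ ‖w‖ * ε := (norm_mul_le _ _).trans (by gcongr)
    linarith [norm_add_le ((x * w - w * x) - c * w) (w * d), norm_sub_le (x * w - w * x) (c * w)]
  refine ⟨α, ‖w‖⁻¹ • w, ?_, fun b => (hwφ b).smul_right _, ?_⟩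
  · rw [norm_smul, norm_inv, norm_norm, inv_mul_cancel₀ hwpos.ne']
  · rw [hαβ, mul_smul_comm, smul_mul_assoc, ← smul_sub, norm_smul, norm_inv, norm_norm]
    have := mul_le_mul_of_nonneg_left hbound (inv_nonneg.2 hwpos.le)
    field_simp at this ⊢
    linarith

lemma nontrivial (hA : IsLM A) : Nontrivial A := by
  obtain ⟨m, hm, φ, hφ, -⟩ := exists_starAlgHom hA ∅ one_pos
  have : Nonempty (Fin m) := ⟨⟨0, hm⟩⟩
  exact hφ.nontrivial

lemma eventually_exists_norm_sub_le (hA : IsLM A) {x : ℕ → A} (hx : IsCentralSequence x)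
    (hsa : ∀ n, IsSelfAdjoint (x n)) (F : Finset A) {ε : ℝ} (hε : 0 < ε) :
    ∀ᶠ n in atTop, ∃ (α : ℝ) (y : A), ‖y‖ ≤ 1 ∧ (∀ a ∈ F, ‖y * a - a * y‖ ≤ ε) ∧
      ‖x n - algebraMap ℝ A α‖ ≤ ‖x n * y - y * x n‖ + ε := by
  have := hA.nontrivial
  obtain ⟨m, hm, φ, -, hF⟩ := exists_starAlgHom hA F (half_pos hε)
  filter_upwards [(tendsto_expect_sub φ hm hx).eventually (gt_mem_nhds (by positivity : 0 < ε / 8))]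
    with n hn
  obtain ⟨α, y, hy, hyφ, hle⟩ := exists_commutant_norm_commutator_ge hA φ
    (isSelfAdjoint_expect φ (hsa n)) (commute_expect φ (x n)) (by positivity : 0 < ε / 8)
  refine ⟨α, y, hy, fun a ha => ?_, ?_⟩
  · obtain ⟨b, hb⟩ := hF a ha
    have h : y * a - a * y = y * (a - φ b) - (a - φ b) * y := by
      simp only [mul_sub, sub_mul, (hyφ b).eq]
      abel
    rw [h]
    have h1 : ‖y * (a - φ b)‖ ≤ 1 * (ε / 2) := (norm_mul_le _ _).trans (by gcongr)
    have h2 : ‖(a - φ b) * y‖ ≤ (ε / 2) * 1 := (norm_mul_le _ _).trans (by gcongr)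
    linarith [norm_sub_le (y * (a - φ b)) ((a - φ b) * y)]
  · set e := expect φ (x n)
    have h1 : ‖x n - algebraMap ℝ A α‖ ≤ ‖e - algebraMap ℝ A α‖ + ‖e - x n‖ := by
      have : x n - algebraMap ℝ A α = (e - algebraMap ℝ A α) - (e - x n) := by abel
      rw [this]
      exact norm_sub_le _ _
    have h2 : ‖e * y - y * e‖ ≤ ‖x n * y - y * x n‖ + ‖(e - x n) * y‖ + ‖y * (e - x n)‖ := by
      have : e * y - y * e = (x n * y - y * x n) + (e - x n) * y - y * (e - x n) := by
        simp only [mul_sub, sub_mul]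
        abel
      rw [this]
      exact (norm_sub_le _ _).trans (by gcongr; exact norm_add_le _ _)
    have h3 : ‖(e - x n) * y‖ ≤ (ε / 8) * 1 := (norm_mul_le _ _).trans (by gcongr)
    have h4 : ‖y * (e - x n)‖ ≤ 1 * (ε / 8) := (norm_mul_le _ _).trans (by gcongr)
    linarith

/-- A diagonal argument: properties `P k` that each hold eventually hold along some `k n → ∞`. -/
lemma exists_tendsto_eventually {P : ℕ → ℕ → Prop} (h : ∀ k, ∀ᶠ n in atTop, P k n) :
    ∃ k : ℕ → ℕ, Tendsto k atTop atTop ∧ ∀ᶠ n in atTop, P (k n) n := by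
  classical
  refine ⟨fun n => Nat.findGreatest (fun k => P k n) n, ?_, ?_⟩
  · refine tendsto_atTop.2 fun K => ?_
    filter_upwards [h K, eventually_ge_atTop K] with n hn hK
    exact Nat.le_findGreatest hK hn
  · filter_upwards [h 0] with n hn
    exact Nat.findGreatest_spec (P := fun k => P k n) (Nat.zero_le n) hn

lemma _root_.isCentralSequence_of_dense {y : ℕ → A} {C : ℝ} (hy : ∀ n, ‖y n‖ ≤ C) {d : ℕ → A}
    (hd : DenseRange d)
    (h : ∀ i, Tendsto (fun n => ‖y n * d i - d i * y n‖) atTop (𝓝 0)) :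
    IsCentralSequence y := by
  refine ⟨⟨C, hy⟩, fun a => ?_⟩
  have hC : 0 ≤ C := (norm_nonneg _).trans (hy 0)
  rw [Metric.tendsto_atTop']
  intro ε hε
  obtain ⟨i, hi⟩ := Metric.denseRange_iff.1 hd a (ε / (4 * (C + 1))) (by positivity)
  rw [dist_eq_norm] at hi
  obtain ⟨N, hN⟩ := Metric.tendsto_atTop'.1 (h i) (ε / 2) (by positivity)
  refine ⟨N, fun n hn => ?_⟩
  have h0 := hN n hn
  simp only [dist_zero_right, norm_norm] at h0 ⊢
  have heq : y n * a - a * y n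
      = (y n * d i - d i * y n) + y n * (a - d i) - (a - d i) * y n := by
    simp only [mul_sub, sub_mul]
    abel
  have h1 : ‖y n * (a - d i)‖ ≤ C * (ε / (4 * (C + 1))) :=
    (norm_mul_le _ _).trans (by gcongr; exact hy n)
  have h2 : ‖(a - d i) * y n‖ ≤ (ε / (4 * (C + 1))) * C :=
    (norm_mul_le _ _).trans (by gcongr; exact hy n)
  have h3 : C * (ε / (4 * (C + 1))) < ε / 4 := by
    rw [mul_div_assoc', div_lt_div_iff₀ (by positivity) (by positivity)]
    nlinarith
  rw [heq]
  linarith [norm_sub_le ((y n * d i - d i * y n) + y n * (a - d i)) ((a - d i) * y n),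
    norm_add_le (y n * d i - d i * y n) (y n * (a - d i))]

lemma exists_tendsto_of_isSelfAdjoint [TopologicalSpace.SeparableSpace A] (hA : IsLM A)
    {x : ℕ → A} (hx : IsHypercentral x) (hsa : ∀ n, IsSelfAdjoint (x n)) :
    ∃ α : ℕ → ℝ, Tendsto (fun n => x n - algebraMap ℝ A (α n)) atTop (𝓝 0) := by
  classical
  let d := TopologicalSpace.denseSeq A
  let ε : ℕ → ℝ := fun k => 1 / ((k : ℝ) + 1)
  have hε : ∀ k, 0 < ε k := fun k => Nat.one_div_pos_of_nat
  let P : ℕ → ℕ → ℝ → A → Prop := fun k n α y =>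
    (∀ a ∈ (Finset.range k).image d, ‖y * a - a * y‖ ≤ ε k) ∧
      ‖x n - algebraMap ℝ A α‖ ≤ ‖x n * y - y * x n‖ + ε k
  obtain ⟨k, hk, hP⟩ := exists_tendsto_eventually fun k =>
    eventually_exists_norm_sub_le hA hx.1 hsa ((Finset.range k).image d) (hε k)
  have hP' : ∀ n, ∃ (α : ℝ) (y : A), ‖y‖ ≤ 1 ∧ ((∃ (α : ℝ) (y : A), ‖y‖ ≤ 1 ∧ P (k n) n α y) →
      P (k n) n α y) := fun n => by
    by_cases h : ∃ (α : ℝ) (y : A), ‖y‖ ≤ 1 ∧ P (k n) n α y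
    · obtain ⟨α, y, hy, hαy⟩ := h
      exact ⟨α, y, hy, fun _ => hαy⟩
    · exact ⟨0, 0, by simp, fun h' => absurd h' h⟩
  choose α y hy hαy using hP'
  have hev : ∀ᶠ n in atTop, P (k n) n (α n) (y n) := hP.mono fun n hn => hαy n hn
  have hε0 : Tendsto (fun n => ε (k n)) atTop (𝓝 0) :=
    tendsto_one_div_add_atTop_nhds_zero_nat.comp hk
  have hycentral : IsCentralSequence y :=
    isCentralSequence_of_dense hy (TopologicalSpace.denseRange_denseSeq A) fun i =>
      squeeze_zero' (Eventually.of_forall fun _ => norm_nonneg _)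
        (by
          filter_upwards [hev, hk.eventually_gt_atTop i] with n hn hi
          exact hn.1 _ (Finset.mem_image_of_mem _ (Finset.mem_range.2 hi))) hε0
  refine ⟨α, tendsto_zero_iff_norm_tendsto_zero.2 ?_⟩
  exact squeeze_zero' (Eventually.of_forall fun _ => norm_nonneg _) (hev.mono fun n hn => hn.2)
    (by simpa using (hx.2 y hycentral).add hε0)

end IsLM

section Hypercentral

variable {A : Type*} [CStarAlgebra A] {x y : ℕ → A}

lemma norm_star_commutator (a b : A) :
    ‖star a * b - b * star a‖ = ‖a * star b - star b * a‖ := by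
  rw [← norm_star, ← norm_neg]
  simp

lemma IsCentralSequence.star (hx : IsCentralSequence x) :
    IsCentralSequence fun n => star (x n) := by
  obtain ⟨⟨C, hC⟩, h⟩ := hx
  refine ⟨⟨C, fun n => by simpa using hC n⟩, fun a => ?_⟩
  simpa only [norm_star_commutator] using h (Star.star a)

lemma IsHypercentral.star (hx : IsHypercentral x) : IsHypercentral fun n => star (x n) := by
  refine ⟨hx.1.star, fun y hy => ?_⟩
  simpa only [norm_star_commutator] using hx.2 _ hy.star

lemma tendsto_commutator_add {b : ℕ → A}
    (hx : Tendsto (fun n => ‖x n * b n - b n * x n‖) atTop (𝓝 0))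
    (hy : Tendsto (fun n => ‖y n * b n - b n * y n‖) atTop (𝓝 0)) :
    Tendsto (fun n => ‖(x n + y n) * b n - b n * (x n + y n)‖) atTop (𝓝 0) := by
  rw [← tendsto_zero_iff_norm_tendsto_zero] at *
  simpa [add_mul, mul_add, add_sub_add_comm] using hx.add hy

lemma tendsto_commutator_smul {b : ℕ → A} (c : ℂ)
    (hx : Tendsto (fun n => ‖x n * b n - b n * x n‖) atTop (𝓝 0)) :
    Tendsto (fun n => ‖(c • x n) * b n - b n * (c • x n)‖) atTop (𝓝 0) := by
  rw [← tendsto_zero_iff_norm_tendsto_zero] at *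
  simpa [smul_sub] using hx.const_smul c

lemma IsHypercentral.add (hx : IsHypercentral x) (hy : IsHypercentral y) :
    IsHypercentral fun n => x n + y n := by
  obtain ⟨⟨⟨C, hC⟩, hx1⟩, hx2⟩ := hx
  obtain ⟨⟨⟨D, hD⟩, hy1⟩, hy2⟩ := hy
  exact ⟨⟨⟨C + D, fun n => (norm_add_le _ _).trans (add_le_add (hC n) (hD n))⟩,
    fun a => tendsto_commutator_add (hx1 a) (hy1 a)⟩,
    fun b hb => tendsto_commutator_add (hx2 b hb) (hy2 b hb)⟩

lemma IsHypercentral.const_smul (hx : IsHypercentral x) (c : ℂ) :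
    IsHypercentral fun n => c • x n := by
  obtain ⟨⟨⟨C, hC⟩, hx1⟩, hx2⟩ := hx
  exact ⟨⟨⟨‖c‖ * C, fun n => by
    rw [norm_smul]; exact mul_le_mul_of_nonneg_left (hC n) (norm_nonneg c)⟩,
    fun a => tendsto_commutator_smul c (hx1 a)⟩, fun b hb => tendsto_commutator_smul c (hx2 b hb)⟩

lemma IsHypercentral.realPart (hx : IsHypercentral x) :
    IsHypercentral fun n => (realPart (x n) : A) := by
  have h := (hx.add hx.star).const_smul (1 / 2)
  convert h using 2 with n
  rw [realPart_apply_coe, ← Complex.coe_smul]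
  norm_num

lemma IsHypercentral.imaginaryPart (hx : IsHypercentral x) :
    IsHypercentral fun n => (imaginaryPart (x n) : A) := by
  have h := (hx.const_smul (-Complex.I)).realPart
  simpa only [neg_smul, map_neg, realPart_I_smul, neg_neg] using h

end Hypercentral

/-- In a separable unital LM algebra every hypercentral sequence is
trivial: it is asymptotically equal to a sequence from the center. -/
theorem stmt_14 {A : Type*} [CStarAlgebra A] [TopologicalSpace.SeparableSpace A]
    (hLM : IsLM A) (x : ℕ → A) (hx : IsHypercentral x) :
    ∃ z : ℕ → A, (∀ n, ∀ a : A, z n * a = a * z n) ∧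
      Filter.Tendsto (fun n => ‖x n - z n‖) Filter.atTop (nhds 0) := by
  obtain ⟨α, hα⟩ := hLM.exists_tendsto_of_isSelfAdjoint hx.realPart fun n => (realPart (x n)).2
  obtain ⟨β, hβ⟩ := hLM.exists_tendsto_of_isSelfAdjoint hx.imaginaryPart
    fun n => (imaginaryPart (x n)).2
  refine ⟨fun n => algebraMap ℝ A (α n) + Complex.I • algebraMap ℝ A (β n), fun n a => ?_, ?_⟩
  · exact ((Algebra.commute_algebraMap_left (α n) a).add_left
      ((Algebra.commute_algebraMap_left (β n) a).smul_left Complex.I)).eq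
  · rw [← tendsto_zero_iff_norm_tendsto_zero]
    have h := hα.add (hβ.const_smul Complex.I)
    simp only [smul_zero, add_zero] at h
    refine h.congr fun n => ?_
    conv_rhs => rw [← realPart_add_I_smul_imaginaryPart (x n)]
    rw [smul_sub, add_sub_add_comm]
end
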